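/- For every real c₀ > 0 there exist constants C₁, C₂ > 0 with the following property. Let B ≥ 16, let T > 0, and let A, Y be reals with 1 ≤ A ≤ √B / Z₁^{c₀} and 1 ≤ Y ≤ B⁵. Then ∑ L†_{a,b,ν,k₁,k₂,λ₁,λ₂,ℓ}(Y; T) ≤ C₁·(A²·Z₁^{C₂}·⌊T⌋ + Y·Z₁^{C₂}/T), where the sum is over: ordered pairs (a,b) of positive integers with gcd(a,b) = 1, ab ≠ 1, ν₂(a² − b²) ≤ Z₂ and max{a,b} ≤ A; integers ν with 0 ≤ ν ≤ Z₂; odd positive integers k₁, λ₁ with k₁λ₁ ∣ a² − b² and k₁ ≤ K; odd positive integers k₂, λ₂ with k₂λ₂ ∣ a² + b² and k₂ ≤ K; and all odd positive integers ℓ. Here Z₁ = B^{1/log log B}, Z₂ = log log B, K = (log B)^{50}, and L†_{a,b,ν,k₁,k₂,λ₁,λ₂,ℓ}(Y; T) is the number of (s,t) ∈ 𝔏(k₁,k₂,λ₁,λ₂,ℓ) lying in R†(2^ν·λ₁·λ₂·Y / max{a,b}) with gcd(s,t) > T. -/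

import Mathlib

open scoped Classical

/-- `Q₁(s,t) = 2s² + (a² − b²)t² − 4ast`. -/
def Q1 (a b s t : ℤ) : ℤ := 2 * s ^ 2 + (a ^ 2 - b ^ 2) * t ^ 2 - 4 * a * s * t

/-- `Q₂(s,t) = −2s² + (a² − b²)t²`. -/
def Q2 (a b s t : ℤ) : ℤ := -2 * s ^ 2 + (a ^ 2 - b ^ 2) * t ^ 2

/-- `Q₃(s,t) = −2as² + 2(a² − b²)st − a(a² − b²)t²`. -/
def Q3 (a b s t : ℤ) : ℤ :=
  -2 * a * s ^ 2 + 2 * (a ^ 2 - b ^ 2) * s * t - a * (a ^ 2 - b ^ 2) * t ^ 2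

/-- The set `R†(X)` of integer points. -/
def Rdag (a b : ℤ) (X : ℝ) : Set (ℤ × ℤ) :=
  {p | Q1 a b p.1 p.2 ≠ 0 ∧ Q2 a b p.1 p.2 ≠ 0 ∧ Q3 a b p.1 p.2 ≠ 0 ∧
    ((|Q1 a b p.1 p.2| : ℤ) : ℝ) ≤ X ∧ ((|Q2 a b p.1 p.2| : ℤ) : ℝ) ≤ X ∧
    p.1 * p.2 * (p.1 - a * p.2) ≠ 0 ∧
    2 * a * p.1 ≠ (a ^ 2 - b ^ 2) * p.2}

/-- `L†`: the number of lattice points of `𝔏(k₁,k₂,λ₁,λ₂,ℓ)` lying in `R†(X)`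
with `gcd(s,t) > T`. -/
noncomputable def Ldag (a b : ℤ) (k₁ k₂ l₁ l₂ ℓ : ℕ) (X T : ℝ) : ℕ :=
  Set.ncard {p : ℤ × ℤ |
    ((Nat.lcm (k₁ * l₁) ℓ : ℕ) : ℤ) ∣ p.1 ∧
    ((k₂ * l₂ : ℕ) : ℤ) ∣ (p.1 - a * p.2) ∧
    ((ℓ : ℕ) : ℤ) ∣ p.2 ∧
    p ∈ Rdag a b X ∧
    T < (Int.gcd p.1 p.2 : ℝ)}

/-- A finite family of reals in `[-L, L]` which is `ε`-separated has at most `2L/ε + 2` members. -/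
lemma card_le_of_separated {ι : Type*} (S : Finset ι) (f : ι → ℝ) {L ε : ℝ} (hL0 : 0 ≤ L) (hε : 0 < ε)
    (hL : ∀ x ∈ S, |f x| ≤ L)
    (hsep : ∀ x ∈ S, ∀ y ∈ S, x ≠ y → ε ≤ |f x - f y|) :
    (S.card : ℝ) ≤ 2 * L / ε + 2 := by
  have hmaps : Set.MapsTo (fun x => ⌊f x / ε⌋) (S : Set ι) (Finset.Icc ⌊-L / ε⌋ ⌊L / ε⌋ : Finset ℤ) := by
    intro x hx
    have := abs_le.1 (hL x hx)
    simp only [Finset.coe_Icc, Set.mem_Icc]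
    constructor <;> apply Int.floor_le_floor <;> gcongr <;> linarith
  have hinj : Set.InjOn (fun x => ⌊f x / ε⌋) (S : Set ι) := by
    intro x hx y hy hxy
    by_contra hne
    have h1 := hsep x hx y hy hne
    have h2 := Int.abs_sub_lt_one_of_floor_eq_floor hxy
    rw [← sub_div, abs_div, abs_of_pos hε, div_lt_one hε] at h2
    linarith
  have hc := Finset.card_le_card_of_injOn _ hmaps hinj
  rw [Int.card_Icc] at hc
  have h3 : (S.card : ℝ) ≤ ((⌊L / ε⌋ + 1 - ⌊-L / ε⌋).toNat : ℝ) := by exact_mod_cast hc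
  have h4 : ((⌊L / ε⌋ + 1 - ⌊-L / ε⌋).toNat : ℤ) = ⌊L / ε⌋ + 1 - ⌊-L / ε⌋ := by
    apply Int.toNat_of_nonneg
    have : ⌊-L / ε⌋ ≤ ⌊L / ε⌋ := by apply Int.floor_le_floor; gcongr; linarith
    linarith
  have h5 : ((⌊L / ε⌋ + 1 - ⌊-L / ε⌋).toNat : ℝ) = ⌊L / ε⌋ + 1 - ⌊-L / ε⌋ := by
    exact_mod_cast h4
  have h6 := Int.floor_le (L / ε)
  have h7 := Int.lt_floor_add_one (-L / ε)
  have h8 : -L / ε = -(L / ε) := by ring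
  have h9 : 2 * L / ε = 2 * (L / ε) := by ring
  linarith

/-- If every fibre of `f` over `T` has at most `g` many points, the whole set has at most `∑ g`. -/
lemma card_le_sum_fiber {ι κ : Type*} [DecidableEq κ] (S : Finset ι) (f : ι → κ) (T : Finset κ) (g : κ → ℝ)
    (hf : ∀ x ∈ S, f x ∈ T)
    (hg : ∀ y ∈ T, ((S.filter (fun x => f x = y)).card : ℝ) ≤ g y) :
    (S.card : ℝ) ≤ ∑ y ∈ T, g y := by
  rw [Finset.card_eq_sum_card_fiberwise (f := f) (t := T) (fun x hx => hf x hx)]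
  push_cast
  exact Finset.sum_le_sum hg

/-- Every positive integer up to `R` has at most `H` divisors. -/
def DivBound (R H : ℝ) : Prop :=
  ∀ n : ℕ, 0 < n → (n : ℝ) ≤ R → (n.divisors.card : ℝ) ≤ H

lemma DivBound.log_succ_le {R H : ℝ} (h : DivBound R H) {n : ℕ} (hn : 0 < n) (hR : (n : ℝ) ≤ R) :
    ((Nat.log 2 n + 1 : ℕ) : ℝ) ≤ H := by
  have h1 := h (2 ^ Nat.log 2 n) (by positivity)
    (le_trans (by exact_mod_cast Nat.pow_log_le_self 2 hn.ne') hR)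
  rwa [Nat.divisors_prime_pow Nat.prime_two, Finset.card_map, Finset.card_range] at h1

lemma DivBound.one_le {R H : ℝ} (h : DivBound R H) (hR : 1 ≤ R) : 1 ≤ H := by
  simpa using h 1 one_pos (by simpa using hR)

lemma DivBound.mono {R R' H : ℝ} (h : DivBound R H) (hR : R' ≤ R) : DivBound R' H :=
  fun n hn hn' => h n hn (hn'.trans hR)

lemma DivBound.sum_inv_le {R H : ℝ} (h : DivBound R H) (hR : 1 ≤ R) {n : ℕ} (hn : (n : ℝ) ≤ R) :
    ∑ i ∈ Finset.Icc 1 n, (1 : ℝ) / i ≤ 2 * H := by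
  have hH := h.one_le hR
  rcases Nat.eq_zero_or_pos n with rfl | hpos
  · simp; linarith
  have h1 := harmonic_le_one_add_log n
  rw [harmonic_eq_sum_Icc] at h1
  push_cast at h1
  simp only [one_div]
  refine h1.trans ?_
  have h2 := h.log_succ_le hpos hn
  have h3 : Real.log n ≤ (Nat.log 2 n + 1 : ℕ) := by
    have h4 : (n : ℝ) ≤ 2 ^ (Nat.log 2 n + 1) := by
      exact_mod_cast (Nat.lt_pow_succ_log_self one_lt_two n).le
    calc Real.log n ≤ Real.log (2 ^ (Nat.log 2 n + 1)) :=
          Real.log_le_log (by exact_mod_cast hpos) h4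
      _ = (Nat.log 2 n + 1 : ℕ) * Real.log 2 := by rw [Real.log_pow]
      _ ≤ (Nat.log 2 n + 1 : ℕ) * 1 := by
          gcongr
          have := Real.log_two_lt_d9
          linarith
      _ = _ := mul_one _
  linarith

/-- Two coprime pairs with vanishing determinant and the same sign of first coordinate agree. -/
lemma eq_of_det_eq_zero {s t s' t' : ℤ} (h : Int.gcd s t = 1) (h' : Int.gcd s' t' = 1)
    (hs : s ≠ 0) (hsign : 0 < s ↔ 0 < s') (hs' : s' ≠ 0) (hdet : s * t' = s' * t) :
    s = s' ∧ t = t' := by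
  have c := Int.isCoprime_iff_gcd_eq_one.2 h
  have c' := Int.isCoprime_iff_gcd_eq_one.2 h'
  have d1 : s ∣ s' := c.dvd_of_dvd_mul_right (Dvd.intro _ hdet)
  have d2 : s' ∣ s := c'.dvd_of_dvd_mul_right (Dvd.intro _ hdet.symm)
  have h3 : s = s' := by
    rcases Int.natAbs_eq_natAbs_iff.1 (Int.natAbs_eq_of_dvd_dvd d1 d2) with h | h
    · exact h
    · omega
  refine ⟨h3, ?_⟩
  subst h3
  exact (mul_left_cancel₀ hs hdet).symm

lemma two_pow_log_le_abs {x : ℤ} (hx : x ≠ 0) : (2 : ℝ) ^ Nat.log 2 x.natAbs ≤ |(x : ℝ)| := by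
  rw [← Int.cast_abs, ← Nat.cast_natAbs]
  exact_mod_cast Nat.pow_log_le_self 2 (Int.natAbs_ne_zero.2 hx)

lemma abs_lt_two_pow_log (x : ℤ) : |(x : ℝ)| < 2 * (2 : ℝ) ^ Nat.log 2 x.natAbs := by
  rw [← Int.cast_abs, ← Nat.cast_natAbs, ← pow_succ']
  exact_mod_cast Nat.lt_pow_succ_log_self one_lt_two x.natAbs

lemma one_le_abs_cast {x : ℤ} (hx : x ≠ 0) : 1 ≤ |(x : ℝ)| := by
  exact_mod_cast Int.one_le_abs hx

lemma card_points_le {a l₁ l₂ : ℤ} {P R H : ℝ} (ha : 0 < a) (hl₁ : 0 < l₁) (hl₂ : 0 < l₂)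
    (hcop : IsCoprime l₁ l₂) (hP : 0 ≤ P) (hH : DivBound R H) (hR1 : 1 ≤ R)
    (hR : (l₁ : ℝ) * l₂ * P ≤ R) (S : Finset (ℤ × ℤ))
    (hS : ∀ x ∈ S, l₁ ∣ x.1 ∧ l₂ ∣ x.1 - a * x.2 ∧ Int.gcd x.1 x.2 = 1 ∧ x.1 ≠ 0 ∧
      x.1 - a * x.2 ≠ 0 ∧ |(x.1 : ℝ) * (x.1 - a * x.2)| ≤ l₁ * l₂ * P) :
    (S.card : ℝ) ≤ 16 * H * (P / a + 1) := by
  have haR : (0 : ℝ) < a := by exact_mod_cast ha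
  have hl₁R : (0 : ℝ) < l₁ := by exact_mod_cast hl₁
  have hl₂R : (0 : ℝ) < l₂ := by exact_mod_cast hl₂
  have hH1 := hH.one_le hR1
  have hfl : 0 < ⌊R⌋₊ := Nat.floor_pos.2 hR1
  have hK := hH.log_succ_le hfl (Nat.floor_le (by linarith))
  set K := Nat.log 2 ⌊R⌋₊ + 1 with hKdef
  have key := card_le_sum_fiber S (fun x => (decide (0 < x.1), Nat.log 2 x.1.natAbs))
    (Finset.univ ×ˢ Finset.range K) (fun _ => 8 * P / a + 2) ?_ ?_
  · refine key.trans ?_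
    rw [Finset.sum_const, nsmul_eq_mul, Finset.card_product, Finset.card_range, Finset.card_univ,
      Fintype.card_bool]
    push_cast at hK ⊢
    have : 0 ≤ P / a := by positivity
    calc (2 * (K : ℝ)) * (8 * P / a + 2) ≤ (2 * H) * (8 * P / a + 2) := by gcongr
      _ ≤ 16 * H * (P / a + 1) := by
        have e : 8 * P / a = 8 * (P / a) := by ring
        rw [e]; nlinarith
  · intro x hx
    obtain ⟨-, -, -, h0, h1, hb⟩ := hS x hx
    simp only [Finset.mem_product, Finset.mem_univ, true_and, Finset.mem_range]
    rw [hKdef, Nat.lt_succ_iff]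
    apply Nat.log_mono_right
    apply Nat.le_floor
    rw [Nat.cast_natAbs, Int.cast_abs]
    have := one_le_abs_cast h1
    push_cast at this
    rw [abs_mul] at hb
    nlinarith [abs_nonneg (x.1 : ℝ)]
  · rintro ⟨sg, k⟩ -
    have hε : (0 : ℝ) < a * (l₁ * l₂) / 4 ^ (k + 1) := by positivity
    have hL0 : (0 : ℝ) ≤ l₁ * l₂ * P / 4 ^ k := by positivity
    have := card_le_of_separated
      (S.filter (fun x => (decide (0 < x.1), Nat.log 2 x.1.natAbs) = (sg, k)))
      (fun x => ((x.1 : ℝ) - a * x.2) / x.1) hL0 hε ?_ ?_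
    · refine this.trans (le_of_eq ?_)
      field_simp
      ring
    · intro x hx
      rw [Finset.mem_filter, Prod.mk.injEq] at hx
      obtain ⟨hx, -, hk⟩ := hx
      obtain ⟨-, -, -, h0, h1, hb⟩ := hS x hx
      have e : ((x.1 : ℝ) - a * x.2) / x.1 = (x.1 : ℝ) * (x.1 - a * x.2) / (x.1 * x.1) := by
        have : (x.1 : ℝ) ≠ 0 := by exact_mod_cast h0
        field_simp
      rw [e, abs_div]
      have h2 := two_pow_log_le_abs h0
      rw [hk] at h2
      have h3 : (4 : ℝ) ^ k ≤ |(x.1 : ℝ) * x.1| := by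
        rw [abs_mul, show (4 : ℝ) = 2 * 2 by norm_num, mul_pow]
        gcongr
      gcongr
    · intro x hx y hy hxy
      rw [Finset.mem_filter, Prod.mk.injEq] at hx hy
      obtain ⟨hx, hsx, hkx⟩ := hx
      obtain ⟨hy, hsy, hky⟩ := hy
      obtain ⟨x1, x2, x3, x4, x5, x6⟩ := hS x hx
      obtain ⟨y1, y2, y3, y4, y5, y6⟩ := hS y hy
      have x4R : (x.1 : ℝ) ≠ 0 := by exact_mod_cast x4
      have y4R : (y.1 : ℝ) ≠ 0 := by exact_mod_cast y4
      have hdet : x.1 * y.2 - y.1 * x.2 ≠ 0 := by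
        intro h
        have hsg : (0 < x.1) ↔ (0 < y.1) := by
          rw [← hsy] at hsx
          simpa using hsx
        have := eq_of_det_eq_zero x3 y3 x4 hsg y4 (sub_eq_zero.1 h)
        exact hxy (Prod.ext this.1 this.2)
      have hd1 : l₁ ∣ x.1 * y.2 - y.1 * x.2 := dvd_sub (x1.mul_right _) (y1.mul_right _)
      have hd2 : l₂ ∣ x.1 * y.2 - y.1 * x.2 := by
        have : x.1 * y.2 - y.1 * x.2 =
            (x.1 - a * x.2) * y.2 - (y.1 - a * y.2) * x.2 := by ring
        rw [this]
        exact dvd_sub (x2.mul_right _) (y2.mul_right _)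
      have hd := Int.le_of_dvd (abs_pos.2 hdet) ((dvd_abs _ _).2 (hcop.mul_dvd hd1 hd2))
      have hdR : (l₁ : ℝ) * l₂ ≤ |(x.1 : ℝ) * y.2 - y.1 * x.2| := by exact_mod_cast hd
      have e : ((x.1 : ℝ) - a * x.2) / x.1 - (y.1 - a * y.2) / y.1 =
          a * ((x.1 : ℝ) * y.2 - y.1 * x.2) / (x.1 * y.1) := by
        field_simp; ring
      rw [e, abs_div, abs_mul, abs_of_pos haR]
      have h1 := abs_lt_two_pow_log x.1
      have h2 := abs_lt_two_pow_log y.1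
      rw [hkx] at h1
      rw [hky] at h2
      have h3 : |(x.1 : ℝ) * y.1| ≤ 4 ^ (k + 1) := by
        rw [abs_mul]
        calc |(x.1 : ℝ)| * |(y.1 : ℝ)| ≤ (2 * 2 ^ k) * (2 * 2 ^ k) := by gcongr
          _ = 4 ^ (k + 1) := by
            rw [show (4 : ℝ) = 2 * 2 by norm_num, mul_pow, pow_succ]; ring
      have h4 : 0 < |(x.1 : ℝ) * y.1| := abs_pos.2 (mul_ne_zero x4R y4R)
      gcongr

/-- The multiplier `g` relating the two points of a bilinear form vanishing on `(x, y)`, `(z, w)`. -/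
lemma exists_multiplier {α β γ x y z w : ℤ} (hΔ : 0 < β ^ 2 - α * γ) (hx : 0 < x) (hz : 0 < z)
    (hxy : Int.gcd x y = 1) (hzw : Int.gcd z w = 1)
    (hF : (α * x + β * y) * z + (β * x + γ * y) * w = 0) :
    ∃ g : ℤ, g = (β * x + γ * y) / z ∧ g ≠ 0 ∧ g ∣ β ^ 2 - α * γ ∧
      β * x + γ * y = g * z ∧ α * x + β * y = -g * w := by
  have c := Int.isCoprime_iff_gcd_eq_one.2 hzw
  have hd : z ∣ β * x + γ * y :=
    c.dvd_of_dvd_mul_right ⟨-(α * x + β * y), by linear_combination hF⟩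
  obtain ⟨g, hg⟩ := hd
  have hg1 : β * x + γ * y = g * z := by rw [hg]; ring
  have hg2 : α * x + β * y = -g * w := by
    apply mul_right_cancel₀ hz.ne'
    linear_combination hF - w * hg1
  refine ⟨g, ?_, ?_, ?_, hg1, hg2⟩
  · rw [hg, Int.mul_ediv_cancel_left _ hz.ne']
  · rintro rfl
    have : (β ^ 2 - α * γ) * x = 0 := by linear_combination β * hg1 - γ * hg2
    rcases mul_eq_zero.1 this with h | h <;> omega
  · have h1 : g ∣ (β ^ 2 - α * γ) * x := ⟨β * z + γ * w, by linear_combination β * hg1 - γ * hg2⟩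
    have h2 : g ∣ (β ^ 2 - α * γ) * y := ⟨-β * w - α * z, by linear_combination β * hg2 - α * hg1⟩
    have h3 : IsCoprime x y := Int.isCoprime_iff_gcd_eq_one.2 hxy
    obtain ⟨p, q, hpq⟩ := h3
    have : β ^ 2 - α * γ = p * ((β ^ 2 - α * γ) * x) + q * ((β ^ 2 - α * γ) * y) := by
      linear_combination -(β ^ 2 - α * γ) * hpq
    rw [this]
    exact dvd_add (h1.mul_left _) (h2.mul_left _)

lemma card_conic_le {α β γ : ℤ} {N R H : ℝ} (hΔ : 0 < β ^ 2 - α * γ) (hN : 1 ≤ N)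
    (hH : DivBound R H) (hNR : N ≤ R) (hΔR : ((β ^ 2 - α * γ : ℤ) : ℝ) ≤ R)
    (S : Finset (ℤ × ℤ × ℤ × ℤ))
    (hS : ∀ p ∈ S, 0 < p.1 ∧ 0 < p.2.2.1 ∧ Int.gcd p.1 p.2.1 = 1 ∧
      Int.gcd p.2.2.1 p.2.2.2 = 1 ∧ p.2.1 ≠ 0 ∧ p.2.2.2 ≠ 0 ∧
      |(p.2.2.1 : ℝ) * p.2.1| ≤ N ∧ |(p.1 : ℝ) * p.2.2.2| ≤ N ∧
      (α * p.1 + β * p.2.1) * p.2.2.1 + (β * p.1 + γ * p.2.1) * p.2.2.2 = 0) :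
    (S.card : ℝ) ≤ 2 * H ^ 3 *
      (8 * (Int.gcd (Int.gcd α β) γ : ℝ) * N / √((β ^ 2 - α * γ : ℤ) : ℝ) + 2) := by
  set c : ℤ := ((Int.gcd (Int.gcd α β) γ : ℕ) : ℤ) with hc
  set Δ : ℤ := β ^ 2 - α * γ with hΔdef
  have hcR : ((Int.gcd (Int.gcd α β) γ : ℕ) : ℝ) = (c : ℝ) := by rw [hc]; push_cast; rfl
  rw [hcR]
  have hc0 : 0 < c := by
    rw [hc]
    refine Int.natCast_pos.2 (Nat.pos_of_ne_zero fun h => ?_)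
    rw [Int.gcd_eq_zero_iff] at h
    obtain ⟨h1, h2⟩ := h
    have h3 : Int.gcd α β = 0 := by exact_mod_cast h1
    rw [Int.gcd_eq_zero_iff] at h3
    rw [hΔdef, h3.1, h3.2] at hΔ
    simp at hΔ
  have hc0R : (0 : ℝ) < c := by exact_mod_cast hc0
  have hΔ0R : (0 : ℝ) < Δ := by exact_mod_cast hΔ
  have hsq : 0 < √(Δ : ℝ) := Real.sqrt_pos.2 hΔ0R
  have hsqq : √(Δ : ℝ) * √(Δ : ℝ) = Δ := Real.mul_self_sqrt hΔ0R.le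
  have hH1 := hH.one_le (hN.trans hNR)
  have hfl : 0 < ⌊N⌋₊ := Nat.floor_pos.2 hN
  have hK := hH.log_succ_le hfl ((Nat.floor_le (by linarith)).trans hNR)
  have hτ : (Δ.natAbs.divisors.card : ℝ) ≤ H := by
    apply hH _ (Int.natAbs_pos.2 hΔ.ne')
    rwa [Nat.cast_natAbs, abs_of_pos hΔ]
  set K := Nat.log 2 ⌊N⌋₊ + 1 with hKdef
  have hlog : ∀ x w : ℤ, x ≠ 0 → w ≠ 0 → |(x : ℝ) * w| ≤ N → Nat.log 2 x.natAbs < K := by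
    intro x w hx hw h
    rw [hKdef, Nat.lt_succ_iff]
    apply Nat.log_mono_right
    apply Nat.le_floor
    rw [Nat.cast_natAbs, Int.cast_abs]
    rw [abs_mul] at h
    nlinarith [one_le_abs_cast hw, abs_nonneg (x : ℝ)]
  have key := card_le_sum_fiber S
    (fun p => (decide (0 < (β * p.1 + γ * p.2.1) / p.2.2.1),
      ((β * p.1 + γ * p.2.1) / p.2.2.1).natAbs, Nat.log 2 p.1.natAbs, Nat.log 2 p.2.2.1.natAbs))
    (Finset.univ ×ˢ Δ.natAbs.divisors ×ˢ Finset.range K ×ˢ Finset.range K)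
    (fun _ => 8 * c * N / √(Δ : ℝ) + 2) ?_ ?_
  · refine key.trans ?_
    rw [Finset.sum_const, nsmul_eq_mul, Finset.card_product, Finset.card_product,
      Finset.card_product, Finset.card_range, Finset.card_univ, Fintype.card_bool]
    have hK0 : (0 : ℝ) ≤ (K : ℝ) := by positivity
    push_cast at hK ⊢
    have h1 : (2 : ℝ) * (Δ.natAbs.divisors.card * (K * K)) ≤ 2 * H ^ 3 := by
      calc (2 : ℝ) * (Δ.natAbs.divisors.card * (K * K)) ≤ 2 * (H * (H * H)) := by gcongr
        _ = 2 * H ^ 3 := by ring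
    gcongr
  · intro p hp
    obtain ⟨h1, h2, h3, h4, h5, h6, h7, h8, h9⟩ := hS p hp
    obtain ⟨g, hg, hg0, hgd, -, -⟩ := exists_multiplier hΔ h1 h2 h3 h4 h9
    simp only [Finset.mem_product, Finset.mem_univ, true_and, Finset.mem_range]
    refine ⟨?_, hlog _ _ h1.ne' h6 h8, hlog _ _ h2.ne' h5 h7⟩
    rw [← hg, Nat.mem_divisors]
    exact ⟨Int.natAbs_dvd_natAbs.2 hgd, Int.natAbs_ne_zero.2 hΔ.ne'⟩
  · rintro ⟨sg, gn, i, j⟩ -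
    set F := S.filter (fun p => (decide (0 < (β * p.1 + γ * p.2.1) / p.2.2.1),
      ((β * p.1 + γ * p.2.1) / p.2.2.1).natAbs, Nat.log 2 p.1.natAbs,
      Nat.log 2 p.2.2.1.natAbs) = (sg, gn, i, j)) with hFdef
    rcases F.eq_empty_or_nonempty with hE | ⟨p₀, hp₀⟩
    · rw [hE]; simp only [Finset.card_empty, Nat.cast_zero]; positivity
    -- the common multiplier
    obtain ⟨g, hg0, hg⟩ : ∃ g : ℤ, g ≠ 0 ∧ ∀ p ∈ F,
        β * p.1 + γ * p.2.1 = g * p.2.2.1 ∧ α * p.1 + β * p.2.1 = -g * p.2.2.2 := by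
      refine ⟨if sg then gn else -gn, ?_, ?_⟩
      all_goals
        have main : ∀ p ∈ F, (if sg then (gn : ℤ) else -gn) ≠ 0 ∧
          β * p.1 + γ * p.2.1 = (if sg then (gn : ℤ) else -gn) * p.2.2.1 ∧
          α * p.1 + β * p.2.1 = -(if sg then (gn : ℤ) else -gn) * p.2.2.2 := by
          intro p hp
          rw [hFdef, Finset.mem_filter, Prod.mk.injEq, Prod.mk.injEq] at hp
          obtain ⟨hp, hsg, hgn, -⟩ := hp
          obtain ⟨h1, h2, h3, h4, h5, h6, h7, h8, h9⟩ := hS p hp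
          obtain ⟨g, hg, hg0, hgd, e1, e2⟩ := exists_multiplier hΔ h1 h2 h3 h4 h9
          rw [← hg] at hsg hgn
          have : (if sg then (gn : ℤ) else -gn) = g := by
            rw [← hsg, ← hgn]
            by_cases h : 0 < g
            · simp [h, abs_of_pos h]
            · simp only [h, decide_false, Bool.false_eq_true, if_false]
              omega
          rw [this]
          exact ⟨hg0, e1, e2⟩
      · exact (main p₀ hp₀).1
      · exact fun p hp => (main p hp).2
    have hgR : (0 : ℝ) < |(g : ℝ)| := abs_pos.2 (by exact_mod_cast hg0)
    have hF : ∀ p ∈ F, 0 < (p.1 : ℝ) ∧ 0 < (p.2.2.1 : ℝ) ∧ 2 ^ i ≤ (p.1 : ℝ) ∧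
        (p.1 : ℝ) ≤ 2 * 2 ^ i ∧ 2 ^ j ≤ (p.2.2.1 : ℝ) ∧ (p.2.2.1 : ℝ) ≤ 2 * 2 ^ j ∧
        |(p.2.2.1 : ℝ) * p.2.1| ≤ N ∧ |(p.1 : ℝ) * p.2.2.2| ≤ N := by
      intro p hp
      rw [hFdef, Finset.mem_filter, Prod.mk.injEq, Prod.mk.injEq, Prod.mk.injEq] at hp
      obtain ⟨hp, -, -, hi, hj⟩ := hp
      obtain ⟨h1, h2, h3, h4, h5, h6, h7, h8, h9⟩ := hS p hp
      have h1R : (0 : ℝ) < p.1 := by exact_mod_cast h1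
      have h2R : (0 : ℝ) < p.2.2.1 := by exact_mod_cast h2
      have a1 := two_pow_log_le_abs h1.ne'
      have a2 := abs_lt_two_pow_log p.1
      have a3 := two_pow_log_le_abs h2.ne'
      have a4 := abs_lt_two_pow_log p.2.2.1
      rw [hi, abs_of_pos h1R] at a1 a2
      rw [hj, abs_of_pos h2R] at a3 a4
      exact ⟨h1R, h2R, a1, a2.le, a3, a4.le, h7, h8⟩
    -- determinants of distinct points
    have hdet : ∀ p ∈ F, ∀ q ∈ F, p ≠ q →
        |(g : ℝ)| / c ≤ |(p.1 : ℝ) * q.2.1 - q.1 * p.2.1| ∧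
        (Δ : ℝ) / (c * |(g : ℝ)|) ≤ |(p.2.2.1 : ℝ) * q.2.2.2 - q.2.2.1 * p.2.2.2| := by
      intro p hp q hq hpq
      obtain ⟨ep1, ep2⟩ := hg p hp
      obtain ⟨eq1, eq2⟩ := hg q hq
      have hpS := (Finset.mem_filter.1 hp).1
      have hqS := (Finset.mem_filter.1 hq).1
      obtain ⟨h1, h2, h3, h4, h5, h6, h7, h8, h9⟩ := hS p hpS
      obtain ⟨k1, k2, k3, k4, k5, k6, k7, k8, k9⟩ := hS q hqS
      set δ := p.1 * q.2.1 - q.1 * p.2.1 with hδ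
      set δ' := p.2.2.1 * q.2.2.2 - q.2.2.1 * p.2.2.2 with hδ'
      have hδ0 : δ ≠ 0 := by
        intro h
        obtain ⟨e1, e2⟩ := eq_of_det_eq_zero h3 k3 h1.ne' (by tauto) k1.ne' (sub_eq_zero.1 h)
        apply hpq
        rw [e1, e2] at ep1 ep2
        have f1 := mul_left_cancel₀ hg0 (ep1.symm.trans eq1)
        have f2 := mul_left_cancel₀ (neg_ne_zero.2 hg0) (ep2.symm.trans eq2)
        exact Prod.ext e1 (Prod.ext e2 (Prod.ext f1 f2))
      have d1 : g ∣ α * δ := ⟨p.2.1 * q.2.2.2 - q.2.1 * p.2.2.2, by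
        rw [hδ]; linear_combination q.2.1 * ep2 - p.2.1 * eq2⟩
      have d2 : g ∣ β * δ := ⟨q.1 * p.2.2.2 - p.1 * q.2.2.2, by
        rw [hδ]; linear_combination p.1 * eq2 - q.1 * ep2⟩
      have d3 : g ∣ γ * δ := ⟨p.1 * q.2.2.1 - q.1 * p.2.2.1, by
        rw [hδ]; linear_combination p.1 * eq1 - q.1 * ep1⟩
      have d4 : g ∣ c * δ := by
        have e1 : g ∣ (Int.gcd α β : ℤ) * δ := by
          rw [Int.gcd_eq_gcd_ab, add_mul]
          refine dvd_add ?_ ?_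
          · rw [mul_right_comm]; exact d1.mul_right _
          · rw [mul_right_comm]; exact d2.mul_right _
        rw [hc, Int.gcd_eq_gcd_ab, add_mul]
        refine dvd_add ?_ ?_
        · rw [mul_right_comm]; exact e1.mul_right _
        · rw [mul_right_comm]; exact d3.mul_right _
      have d5 : |g| ≤ c * |δ| := by
        have := Int.le_of_dvd (abs_pos.2 (mul_ne_zero hc0.ne' hδ0))
          ((dvd_abs _ _).2 ((abs_dvd _ _).2 d4))
        rwa [abs_mul, abs_of_pos hc0] at this
      have d6 : Δ * δ = -(g ^ 2 * δ') := by
        rw [hΔdef, hδ, hδ']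
        linear_combination (-(β * q.1 + γ * q.2.1)) * ep2 + (g * p.2.2.2) * eq1
          + (β * p.1 + γ * p.2.1) * eq2 - g * q.2.2.2 * ep1
      have d5R : |(g : ℝ)| ≤ c * |(δ : ℝ)| := by exact_mod_cast d5
      have d6R : (Δ : ℝ) * |(δ : ℝ)| = |(g : ℝ)| ^ 2 * |(δ' : ℝ)| := by
        have : (Δ : ℝ) * δ = -((g : ℝ) ^ 2 * δ') := by exact_mod_cast d6
        have h := congrArg abs this
        rwa [abs_mul, abs_neg, abs_mul, abs_pow, abs_of_pos hΔ0R] at h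
      have e1 : (p.1 : ℝ) * q.2.1 - q.1 * p.2.1 = (δ : ℝ) := by rw [hδ]; push_cast; ring
      have e2 : (p.2.2.1 : ℝ) * q.2.2.2 - q.2.2.1 * p.2.2.2 = (δ' : ℝ) := by
        rw [hδ']; push_cast; ring
      rw [e1, e2]
      constructor
      · rw [div_le_iff₀ hc0R]; linarith
      · rw [div_le_iff₀ (by positivity)]
        have : (Δ : ℝ) * |(g : ℝ)| ≤ |(δ' : ℝ)| * (c * |(g : ℝ)|) * |(g : ℝ)| := by
          calc (Δ : ℝ) * |(g : ℝ)| ≤ Δ * (c * |(δ : ℝ)|) := by gcongr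
            _ = c * (Δ * |(δ : ℝ)|) := by ring
            _ = _ := by rw [d6R]; ring
        exact le_of_mul_le_mul_right this hgR
    by_cases hcase : (2 : ℝ) ^ i * √(Δ : ℝ) ≤ 2 ^ j * |(g : ℝ)|
    · have := card_le_of_separated F (fun p => (p.2.1 : ℝ) / p.1) (L := N / (2 ^ j * 2 ^ i))
        (ε := |(g : ℝ)| / c / (4 * (2 ^ i * 2 ^ i))) (by positivity) (by positivity) ?_ ?_
      · refine this.trans ?_
        have : 2 * (N / (2 ^ j * 2 ^ i)) / (|(g : ℝ)| / c / (4 * (2 ^ i * 2 ^ i))) =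
            8 * c * N * (2 ^ i / (2 ^ j * |(g : ℝ)|)) := by
          field_simp; ring
        have h2 : (2 : ℝ) ^ i / (2 ^ j * |(g : ℝ)|) ≤ 1 / √(Δ : ℝ) := by
          rw [div_le_div_iff₀ (by positivity) hsq]; linarith
        have h3 : 8 * c * N / √(Δ : ℝ) = 8 * c * N * (1 / √(Δ : ℝ)) := by ring
        rw [this, h3]
        gcongr
      · intro p hp
        obtain ⟨h1, h2, h3, h4, h5, h6, h7, h8⟩ := hF p hp
        have e : (p.2.1 : ℝ) / p.1 = (p.2.2.1 * p.2.1) / (p.2.2.1 * p.1) := by field_simp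
        rw [e, abs_div, abs_of_pos (mul_pos h2 h1)]
        gcongr
      · intro p hp q hq hpq
        obtain ⟨h1, h2, h3, h4, h5, h6, h7, h8⟩ := hF p hp
        obtain ⟨k1, k2, k3, k4, k5, k6, k7, k8⟩ := hF q hq
        have e : (p.2.1 : ℝ) / p.1 - q.2.1 / q.1 =
          -((p.1 : ℝ) * q.2.1 - q.1 * p.2.1) / (p.1 * q.1) := by field_simp; ring
        rw [e, abs_div, abs_neg, abs_of_pos (mul_pos h1 k1)]
        have := (hdet p hp q hq hpq).1
        have h9 : (p.1 : ℝ) * q.1 ≤ 4 * (2 ^ i * 2 ^ i) := by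
          calc (p.1 : ℝ) * q.1 ≤ (2 * 2 ^ i) * (2 * 2 ^ i) := by gcongr
            _ = _ := by ring
        have := mul_pos h1 k1
        gcongr
    · have := card_le_of_separated F (fun p => (p.2.2.2 : ℝ) / p.2.2.1) (L := N / (2 ^ j * 2 ^ i))
        (ε := Δ / (c * |(g : ℝ)|) / (4 * (2 ^ j * 2 ^ j))) (by positivity) (by positivity) ?_ ?_
      · refine this.trans ?_
        have : 2 * (N / (2 ^ j * 2 ^ i)) / ((Δ : ℝ) / (c * |(g : ℝ)|) / (4 * (2 ^ j * 2 ^ j))) =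
            8 * c * N * (2 ^ j * |(g : ℝ)| / (2 ^ i * Δ)) := by
          field_simp; ring
        have h2 : (2 : ℝ) ^ j * |(g : ℝ)| / (2 ^ i * Δ) ≤ 1 / √(Δ : ℝ) := by
          rw [div_le_div_iff₀ (by positivity) hsq, one_mul]
          calc (2 : ℝ) ^ j * |(g : ℝ)| * √(Δ : ℝ) ≤ (2 ^ i * √(Δ : ℝ)) * √(Δ : ℝ) :=
                mul_le_mul_of_nonneg_right (not_le.1 hcase).le hsq.le
            _ = 2 ^ i * Δ := by rw [mul_assoc, hsqq]
        have h3 : 8 * c * N / √(Δ : ℝ) = 8 * c * N * (1 / √(Δ : ℝ)) := by ring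
        rw [this, h3]
        gcongr
      · intro p hp
        obtain ⟨h1, h2, h3, h4, h5, h6, h7, h8⟩ := hF p hp
        have e : (p.2.2.2 : ℝ) / p.2.2.1 = (p.1 * p.2.2.2) / (p.2.2.1 * p.1) := by field_simp
        rw [e, abs_div, abs_of_pos (mul_pos h2 h1)]
        gcongr
      · intro p hp q hq hpq
        obtain ⟨h1, h2, h3, h4, h5, h6, h7, h8⟩ := hF p hp
        obtain ⟨k1, k2, k3, k4, k5, k6, k7, k8⟩ := hF q hq
        have e : (p.2.2.2 : ℝ) / p.2.2.1 - q.2.2.2 / q.2.2.1 =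
          -((p.2.2.1 : ℝ) * q.2.2.2 - q.2.2.1 * p.2.2.2) / (p.2.2.1 * q.2.2.1) := by
            field_simp; ring
        rw [e, abs_div, abs_neg, abs_of_pos (mul_pos h2 k2)]
        have := (hdet p hp q hq hpq).2
        have h9 : (p.2.2.1 : ℝ) * q.2.2.1 ≤ 4 * (2 ^ j * 2 ^ j) := by
          calc (p.2.2.1 : ℝ) * q.2.2.1 ≤ (2 * 2 ^ j) * (2 * 2 ^ j) := by gcongr
            _ = _ := by ring
        have := mul_pos h2 k2
        gcongr

lemma sum_gcd_le (n : ℕ) : ∑ m ∈ Finset.Icc 1 n, Nat.gcd m n ≤ n * n.divisors.card := by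
  rcases Nat.eq_zero_or_pos n with rfl | hn
  · simp
  calc ∑ m ∈ Finset.Icc 1 n, Nat.gcd m n
      ≤ ∑ m ∈ Finset.Icc 1 n, ∑ h ∈ n.divisors, if h ∣ m then h else 0 := by
        refine Finset.sum_le_sum fun m _ => ?_
        have := Finset.single_le_sum (f := fun h => if h ∣ m then h else 0)
          (fun _ _ => Nat.zero_le _) (Nat.mem_divisors.2 ⟨Nat.gcd_dvd_right m n, hn.ne'⟩)
        simpa [Nat.gcd_dvd_left] using this
    _ = ∑ h ∈ n.divisors, ∑ m ∈ Finset.Icc 1 n, if h ∣ m then h else 0 := Finset.sum_comm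
    _ = ∑ h ∈ n.divisors, n := by
        refine Finset.sum_congr rfl fun h hh => ?_
        rw [← Finset.sum_filter, Finset.sum_const, smul_eq_mul,
          show Finset.Icc 1 n = Finset.Ioc 0 n from rfl, Nat.Ioc_filter_dvd_card_eq_div,
          Nat.div_mul_cancel (Nat.dvd_of_mem_divisors hh)]
    _ = n * n.divisors.card := by rw [Finset.sum_const, smul_eq_mul, mul_comm]

lemma sum_gcd_div_max_le {R H : ℝ} (hH : DivBound R H) {N : ℕ} (hN : (N : ℝ) ≤ R) :
    ∑ n₁ ∈ Finset.Icc 1 N, ∑ n₂ ∈ Finset.Icc 1 N, (Nat.gcd n₁ n₂ : ℝ) / (max n₁ n₂ : ℕ) ≤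
      2 * N * H := by
  have one : ∀ n ∈ Finset.Icc 1 N,
      ∑ m ∈ Finset.Icc 1 N, (if m ≤ n then (Nat.gcd m n : ℝ) / n else 0) ≤ H := by
    intro n hn
    rw [Finset.mem_Icc] at hn
    have hn0 : (0 : ℝ) < n := by exact_mod_cast hn.1
    rw [← Finset.sum_filter]
    have : (Finset.Icc 1 N).filter (fun m => m ≤ n) = Finset.Icc 1 n := by
      ext m; simp only [Finset.mem_filter, Finset.mem_Icc]; omega
    rw [this, ← Finset.sum_div, div_le_iff₀ hn0]
    have h1 := sum_gcd_le n
    have h2 := hH n hn.1 (le_trans (by exact_mod_cast hn.2) hN)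
    calc ∑ m ∈ Finset.Icc 1 n, (Nat.gcd m n : ℝ) ≤ (n * n.divisors.card : ℕ) := by
          exact_mod_cast h1
      _ = n.divisors.card * (n : ℝ) := by push_cast; ring
      _ ≤ H * n := by gcongr
  have two : ∑ n ∈ Finset.Icc 1 N,
      ∑ m ∈ Finset.Icc 1 N, (if m ≤ n then (Nat.gcd m n : ℝ) / n else 0) ≤ N * H := by
    refine (Finset.sum_le_sum one).trans (le_of_eq ?_)
    simp
  calc _ ≤ ∑ n₁ ∈ Finset.Icc 1 N, ∑ n₂ ∈ Finset.Icc 1 N,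
        ((if n₁ ≤ n₂ then (Nat.gcd n₁ n₂ : ℝ) / n₂ else 0) +
          (if n₂ ≤ n₁ then (Nat.gcd n₂ n₁ : ℝ) / n₁ else 0)) := by
        refine Finset.sum_le_sum fun i _ => Finset.sum_le_sum fun j _ => ?_
        rcases le_total i j with h | h
        · rw [if_pos h, max_eq_right h]
          have : (0 : ℝ) ≤ if j ≤ i then (Nat.gcd j i : ℝ) / i else 0 := by
            split_ifs <;> positivity
          linarith
        · rw [if_pos h, max_eq_left h, Nat.gcd_comm i j]
          have : (0 : ℝ) ≤ if i ≤ j then (Nat.gcd j i : ℝ) / j else 0 := by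
            split_ifs <;> positivity
          linarith
    _ ≤ 2 * N * H := by
        simp only [Finset.sum_add_distrib]
        rw [Finset.sum_comm]
        linarith

/-- The integers dividing a natural number. -/
noncomputable def intDivisors (n : ℕ) : Finset ℤ :=
  (n.divisors.image (fun d : ℕ => (d : ℤ))) ∪ (n.divisors.image (fun d : ℕ => -(d : ℤ)))

lemma mem_intDivisors {n : ℕ} {u : ℤ} (hn : n ≠ 0) (h : u.natAbs ∣ n) : u ∈ intDivisors n := by
  have h1 : u.natAbs ∈ n.divisors := Nat.mem_divisors.2 ⟨h, hn⟩
  rw [intDivisors, Finset.mem_union, Finset.mem_image, Finset.mem_image]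
  rcases Int.natAbs_eq u with h2 | h2
  · exact Or.inl ⟨_, h1, h2.symm⟩
  · exact Or.inr ⟨_, h1, h2.symm⟩

lemma card_intDivisors_le (n : ℕ) : (intDivisors n).card ≤ 2 * n.divisors.card := by
  refine (Finset.card_union_le _ _).trans ?_
  have h1 := Finset.card_image_le (s := n.divisors) (f := fun d : ℕ => (d : ℤ))
  have h2 := Finset.card_image_le (s := n.divisors) (f := fun d : ℕ => -(d : ℤ))
  omega

/-- The data `(a, b)`, `(λ₁, λ₂)`, `(s, t)` of a counted point. -/
@[ext]
structure Config where
  a : ℤ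
  b : ℤ
  l₁ : ℤ
  l₂ : ℤ
  s : ℤ
  t : ℤ

/-- The linear form `(a² − b²)t − 2as`. -/
def Config.q (x : Config) : ℤ := (x.a ^ 2 - x.b ^ 2) * x.t - 2 * x.a * x.s

/-- The arithmetic and size conditions on a counted point. -/
structure Adm (W : ℝ) (x : Config) : Prop where
  ha : 0 < x.a
  hb : 0 < x.b
  hab : Int.gcd x.a x.b = 1
  hne : x.a ≠ x.b
  hl₁ : 0 < x.l₁
  hl₂ : 0 < x.l₂
  odd₁ : Odd x.l₁
  odd₂ : Odd x.l₂
  dvd₁ : x.l₁ ∣ x.a ^ 2 - x.b ^ 2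
  dvd₂ : x.l₂ ∣ x.a ^ 2 + x.b ^ 2
  dvds₁ : x.l₁ ∣ x.s
  dvds₂ : x.l₂ ∣ x.s - x.a * x.t
  s0 : x.s ≠ 0
  t0 : x.t ≠ 0
  v0 : x.s - x.a * x.t ≠ 0
  q0 : x.q ≠ 0
  bd₁ : |((x.s * (x.s - x.a * x.t) : ℤ) : ℝ)| * (max x.a x.b : ℤ) ≤ x.l₁ * x.l₂ * W
  bd₂ : |((x.t * x.q : ℤ) : ℝ)| * (max x.a x.b : ℤ) ≤ x.l₁ * x.l₂ * W

lemma isCoprime_odd_dvd {a b x y : ℤ} (h : IsCoprime a b) (hx : Odd x) (hx1 : x ∣ a - b)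
    (hy : y ∣ a + b) : IsCoprime x y := by
  obtain ⟨p, q, hpq⟩ := h
  obtain ⟨k, hk⟩ := hx
  obtain ⟨m, hm⟩ := hx1
  obtain ⟨n, hn⟩ := hy
  refine ⟨1 - k * (p - q) * m, -k * (p + q) * n, ?_⟩
  linear_combination hk - 2 * k * hpq + k * (p - q) * hm + k * (p + q) * hn

lemma isCoprime_odd_divisors {a b l₁ l₂ : ℤ} (h : IsCoprime a b) (o₁ : Odd l₁)
    (h₁ : l₁ ∣ a ^ 2 - b ^ 2) (h₂ : l₂ ∣ a ^ 2 + b ^ 2) : IsCoprime l₁ l₂ :=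
  isCoprime_odd_dvd (h.pow (m := 2) (n := 2)) o₁ h₁ h₂

namespace Adm

variable {W : ℝ} {x : Config}

lemma isCoprime (h : Adm W x) : IsCoprime x.l₁ x.l₂ :=
  isCoprime_odd_divisors (Int.isCoprime_iff_gcd_eq_one.2 h.hab) h.odd₁ h.dvd₁ h.dvd₂

lemma dvd_q (h : Adm W x) : x.l₁ * x.l₂ ∣ x.q := by
  refine h.isCoprime.mul_dvd ?_ ?_
  · exact dvd_sub (h.dvd₁.mul_right _) (h.dvds₁.mul_left _)
  · have : x.q = -((x.a ^ 2 + x.b ^ 2) * x.t) - 2 * x.a * (x.s - x.a * x.t) := by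
      rw [Config.q]; ring
    rw [this]
    exact dvd_sub ((h.dvd₂.mul_right _).neg_right) (h.dvds₂.mul_left _)

lemma sub_ne_zero (h : Adm W x) : x.a ^ 2 - x.b ^ 2 ≠ 0 := by
  have : x.a ^ 2 - x.b ^ 2 = (x.a - x.b) * (x.a + x.b) := by ring
  rw [this]
  have := h.ha
  have := h.hb
  exact mul_ne_zero (_root_.sub_ne_zero.2 h.hne) (by omega)

lemma add_pos (h : Adm W x) : 0 < x.a ^ 2 + x.b ^ 2 := by
  have := h.ha
  positivity

lemma max_pos (h : Adm W x) : (0 : ℝ) < (max x.a x.b : ℤ) := by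
  exact_mod_cast lt_max_of_lt_left h.ha

lemma quotients (h : Adm W x) : ∃ u v r : ℤ, x.s = x.l₁ * u ∧ x.s - x.a * x.t = x.l₂ * v ∧
    x.q = x.l₁ * x.l₂ * r ∧ u ≠ 0 ∧ v ≠ 0 ∧ r ≠ 0 ∧
    |((u * v : ℤ) : ℝ)| * (max x.a x.b : ℤ) ≤ W ∧ |((x.t * r : ℤ) : ℝ)| * (max x.a x.b : ℤ) ≤ W := by
  obtain ⟨u, hu⟩ := h.dvds₁
  obtain ⟨v, hv⟩ := h.dvds₂
  obtain ⟨r, hr⟩ := h.dvd_q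
  have l1 : (0 : ℝ) < x.l₁ := by exact_mod_cast h.hl₁
  have l2 : (0 : ℝ) < x.l₂ := by exact_mod_cast h.hl₂
  refine ⟨u, v, r, hu, hv, hr, ?_, ?_, ?_, ?_, ?_⟩
  · rintro rfl; exact h.s0 (by simpa using hu)
  · rintro rfl; exact h.v0 (by simpa using hv)
  · rintro rfl; exact h.q0 (by simpa using hr)
  · have := h.bd₁
    rw [hv, hu, show x.l₁ * u * (x.l₂ * v) = x.l₁ * x.l₂ * (u * v) by ring, Int.cast_mul,
      abs_mul, Int.cast_mul, abs_of_pos (mul_pos l1 l2), mul_assoc] at this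
    exact le_of_mul_le_mul_left this (mul_pos l1 l2)
  · have := h.bd₂
    rw [hr, show x.t * (x.l₁ * x.l₂ * r) = x.l₁ * x.l₂ * (x.t * r) by ring, Int.cast_mul,
      abs_mul, Int.cast_mul, abs_of_pos (mul_pos l1 l2), mul_assoc] at this
    exact le_of_mul_le_mul_left this (mul_pos l1 l2)

lemma max_le (h : Adm W x) : ((max x.a x.b : ℤ) : ℝ) ≤ W := by
  obtain ⟨u, v, r, -, -, -, hu, hv, -, h1, -⟩ := h.quotients
  have h2 := one_le_abs_cast (mul_ne_zero hu hv)
  have h3 := h.max_pos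
  nlinarith

end Adm

/-- Points with `(a, b)` and `(λ₁, λ₂)` fixed. -/
lemma card_fixed_le {a b l₁ l₂ : ℤ} {A V W H : ℝ} (hA : 1 ≤ A) (hW : 1 ≤ W)
    (hH : DivBound (8 * A ^ 4 * W ^ 2) H) (hV : 0 ≤ V) (hVW : V ≤ W)
    (ha : 0 < a) (hb : 0 < b) (haA : (a : ℝ) ≤ A) (hbA : (b : ℝ) ≤ A) (F : Finset Config)
    (hF : ∀ x ∈ F, Adm V x ∧ Int.gcd x.s x.t = 1 ∧ x.a = a ∧ x.b = b ∧ x.l₁ = l₁ ∧ x.l₂ = l₂) :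
    (F.card : ℝ) ≤ 16 * H * (V / (a * b) + 1) := by
  have haR : (0 : ℝ) < a := by exact_mod_cast ha
  have hbR : (0 : ℝ) < b := by exact_mod_cast hb
  have hA4 := one_le_pow₀ hA (n := 4)
  have hW2 := one_le_pow₀ hW (n := 2)
  have hR1 : 1 ≤ 8 * A ^ 4 * W ^ 2 := by nlinarith
  have hH1 := hH.one_le hR1
  rcases F.eq_empty_or_nonempty with hE | ⟨x₁, hx₁⟩
  · rw [hE]; simp only [Finset.card_empty, Nat.cast_zero]; positivity
  obtain ⟨k, -, ka, kb, kl1, kl2⟩ := hF x₁ hx₁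
  have hm0 : 0 < l₁ := by have := k.hl₁; rwa [kl1] at this
  have hn0 : 0 < l₂ := by have := k.hl₂; rwa [kl2] at this
  have hcop : IsCoprime l₁ l₂ := by have := k.isCoprime; rwa [kl1, kl2] at this
  have hd1 : l₁ ∣ a ^ 2 - b ^ 2 := by have := k.dvd₁; rwa [kl1, ka, kb] at this
  have hd2 : l₂ ∣ a ^ 2 + b ^ 2 := by have := k.dvd₂; rwa [kl2, ka, kb] at this
  have hne : a ^ 2 - b ^ 2 ≠ 0 := by have := k.sub_ne_zero; rwa [ka, kb] at this
  have hpos : 0 < a ^ 2 + b ^ 2 := by positivity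
  have ha2 : (a : ℝ) ^ 2 ≤ A ^ 2 := by gcongr
  have hb2 : (b : ℝ) ^ 2 ≤ A ^ 2 := by gcongr
  have hM : (0 : ℝ) < (max a b : ℤ) := by exact_mod_cast lt_max_of_lt_left ha
  have hMb : (b : ℝ) ≤ (max a b : ℤ) := by exact_mod_cast le_max_right a b
  have hM1 : (1 : ℝ) ≤ (max a b : ℤ) := by exact_mod_cast (lt_max_of_lt_left ha : 0 < max a b)
  have hinj : Set.InjOn (fun x : Config => (x.s, x.t)) (F : Set Config) := by
    intro x hx y hy hxy
    obtain ⟨-, -, x1, x2, x3, x4⟩ := hF x hx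
    obtain ⟨-, -, y1, y2, y3, y4⟩ := hF y hy
    rw [Prod.mk.injEq] at hxy
    exact Config.ext (x1.trans y1.symm) (x2.trans y2.symm) (x3.trans y3.symm) (x4.trans y4.symm)
      hxy.1 hxy.2
  rw [← Finset.card_image_of_injOn hinj]
  have hmle : (l₁ : ℝ) ≤ A ^ 2 := by
    have h1 : l₁ ≤ |a ^ 2 - b ^ 2| := Int.le_of_dvd (abs_pos.2 hne) ((dvd_abs _ _).2 hd1)
    have h2 : (l₁ : ℝ) ≤ |(a : ℝ) ^ 2 - b ^ 2| := by exact_mod_cast h1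
    refine h2.trans (abs_le.2 ⟨?_, ?_⟩) <;> nlinarith
  have hnle : (l₂ : ℝ) ≤ 2 * A ^ 2 := by
    have h1 : l₂ ≤ a ^ 2 + b ^ 2 := Int.le_of_dvd hpos hd2
    have h2 : (l₂ : ℝ) ≤ (a : ℝ) ^ 2 + b ^ 2 := by exact_mod_cast h1
    linarith
  have hm0R : (0 : ℝ) < l₁ := by exact_mod_cast hm0
  have hn0R : (0 : ℝ) < l₂ := by exact_mod_cast hn0
  have hVM : V / (max a b : ℤ) ≤ W := (div_le_self hV hM1).trans hVW
  have hVM0 : 0 ≤ V / (max a b : ℤ) := by positivity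
  have hR : (l₁ : ℝ) * l₂ * (V / (max a b : ℤ)) ≤ 8 * A ^ 4 * W ^ 2 := by
    calc (l₁ : ℝ) * l₂ * (V / (max a b : ℤ)) ≤ A ^ 2 * (2 * A ^ 2) * W := by gcongr
      _ = 2 * A ^ 4 * W := by ring
      _ ≤ 8 * A ^ 4 * W ^ 2 := by
        have : W ≤ W ^ 2 := by nlinarith
        have : A ^ 4 * W ≤ A ^ 4 * W ^ 2 := by gcongr
        nlinarith
  have := card_points_le ha hm0 hn0 hcop hVM0 hH hR1 hR
    (F.image (fun x : Config => (x.s, x.t))) ?_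
  · refine this.trans ?_
    have : V / (max a b : ℤ) / a ≤ V / (a * b) := by
      rw [div_div]
      refine div_le_div_of_nonneg_left hV (by positivity) ?_
      nlinarith
    gcongr
  · intro p hp
    obtain ⟨x, hx, rfl⟩ := Finset.mem_image.1 hp
    obtain ⟨h, hc, e1, e2, e3, e4⟩ := hF x hx
    have d1 := h.dvds₁
    have d2 := h.dvds₂
    have d3 := h.v0
    have := h.bd₁
    rw [e1, e2, e3, e4] at this
    rw [e3] at d1
    rw [e4, e1] at d2
    rw [e1] at d3
    refine ⟨d1, d2, hc, h.s0, d3, ?_⟩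
    rw [← mul_div_assoc, le_div_iff₀ hM]
    simpa only [Int.cast_mul, Int.cast_sub] using this

/-- Points with `(a, b)` fixed. -/
lemma card_fixed_ab_le {a b : ℤ} {A V W H : ℝ} (hA : 1 ≤ A) (hW : 1 ≤ W)
    (hH : DivBound (8 * A ^ 4 * W ^ 2) H) (hV : 0 ≤ V) (hVW : V ≤ W)
    (ha : 0 < a) (hb : 0 < b) (haA : (a : ℝ) ≤ A) (hbA : (b : ℝ) ≤ A) (S : Finset Config)
    (hS : ∀ x ∈ S, Adm V x ∧ Int.gcd x.s x.t = 1 ∧ x.a = a ∧ x.b = b) :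
    (S.card : ℝ) ≤ 16 * H ^ 3 * (V / (a * b) + 1) := by
  have haR : (0 : ℝ) < a := by exact_mod_cast ha
  have hbR : (0 : ℝ) < b := by exact_mod_cast hb
  have hA4 := one_le_pow₀ hA (n := 4)
  have hA2 := one_le_pow₀ hA (n := 2)
  have hW2 := one_le_pow₀ hW (n := 2)
  have hR1 : 1 ≤ 8 * A ^ 4 * W ^ 2 := by nlinarith
  have hH1 := hH.one_le hR1
  rcases S.eq_empty_or_nonempty with rfl | ⟨x₀, hx₀⟩
  · simp only [Finset.card_empty, Nat.cast_zero]; positivity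
  obtain ⟨h0, -, ea, eb⟩ := hS x₀ hx₀
  have hne : a ^ 2 - b ^ 2 ≠ 0 := by have := h0.sub_ne_zero; rwa [ea, eb] at this
  have hpos : 0 < a ^ 2 + b ^ 2 := by positivity
  have ha2 : (a : ℝ) ^ 2 ≤ A ^ 2 := by gcongr
  have hb2 : (b : ℝ) ^ 2 ≤ A ^ 2 := by gcongr
  have hR2 : 2 * A ^ 2 ≤ 8 * A ^ 4 * W ^ 2 := by
    have : A ^ 2 ≤ A ^ 4 := pow_le_pow_right₀ hA (by norm_num)
    nlinarith
  have t1 : ((a ^ 2 - b ^ 2).natAbs.divisors.card : ℝ) ≤ H := by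
    apply hH _ (Int.natAbs_pos.2 hne)
    rw [Nat.cast_natAbs, Int.cast_abs]
    push_cast
    refine (abs_le.2 ⟨?_, ?_⟩ : _ ≤ A ^ 2).trans ?_ <;> nlinarith
  have t2 : ((a ^ 2 + b ^ 2).natAbs.divisors.card : ℝ) ≤ H := by
    apply hH _ (Int.natAbs_pos.2 hpos.ne')
    rw [Nat.cast_natAbs, Int.cast_abs]
    push_cast
    refine (abs_le.2 ⟨?_, ?_⟩ : _ ≤ 2 * A ^ 2).trans ?_ <;> nlinarith
  have hab0 : 0 ≤ V / (a * b) := by positivity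
  have key := card_le_sum_fiber S (fun x => (x.l₁.natAbs, x.l₂.natAbs))
    ((a ^ 2 - b ^ 2).natAbs.divisors ×ˢ (a ^ 2 + b ^ 2).natAbs.divisors)
    (fun _ => 16 * H * (V / (a * b) + 1)) ?_ ?_
  · refine key.trans ?_
    rw [Finset.sum_const, nsmul_eq_mul, Finset.card_product]
    push_cast
    calc ((a ^ 2 - b ^ 2).natAbs.divisors.card : ℝ) * (a ^ 2 + b ^ 2).natAbs.divisors.card *
          (16 * H * (V / (a * b) + 1)) ≤ H * H * (16 * H * (V / (a * b) + 1)) := by gcongr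
      _ = _ := by ring
  · intro x hx
    obtain ⟨h, -, ea, eb⟩ := hS x hx
    have d1 := h.dvd₁
    have d2 := h.dvd₂
    rw [ea, eb] at d1 d2
    rw [Finset.mem_product, Nat.mem_divisors, Nat.mem_divisors]
    exact ⟨⟨Int.natAbs_dvd_natAbs.2 d1, Int.natAbs_ne_zero.2 hne⟩,
      ⟨Int.natAbs_dvd_natAbs.2 d2, Int.natAbs_ne_zero.2 hpos.ne'⟩⟩
  · rintro ⟨m, n⟩ -
    refine card_fixed_le (l₁ := m) (l₂ := n) hA hW hH hV hVW ha hb haA hbA _ ?_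
    intro x hx
    rw [Finset.mem_filter, Prod.mk.injEq] at hx
    obtain ⟨hx, e1, e2⟩ := hx
    obtain ⟨h, h1, h2, h3⟩ := hS x hx
    have := h.hl₁
    have := h.hl₂
    exact ⟨h, h1, h2, h3, by omega, by omega⟩

lemma gcd_coeff_le {u v t r : ℤ} (hu : u ≠ 0) (hv : v ≠ 0) :
    Int.gcd (Int.gcd (-2 * u * r) (r * t - 2 * u * v)) (2 * v * t) ≤
      4 * Nat.gcd (u * v).natAbs (t * r).natAbs := by
  set c := Int.gcd (Int.gcd (-2 * u * r) (r * t - 2 * u * v)) (2 * v * t) with hc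
  have c0 : (c : ℤ) ∣ Int.gcd (-2 * u * r) (r * t - 2 * u * v) := Int.gcd_dvd_left ..
  have c1 : (c : ℤ) ∣ -2 * u * r := c0.trans (Int.gcd_dvd_left ..)
  have c2 : (c : ℤ) ∣ r * t - 2 * u * v := c0.trans (Int.gcd_dvd_right ..)
  have c3 : (c : ℤ) ∣ 2 * v * t := Int.gcd_dvd_right ..
  obtain ⟨k, hk⟩ := c2
  have h4 : (c : ℤ) ^ 2 ∣ (2 * (2 * u * v) + c * k) ^ 2 := by
    obtain ⟨m, hm⟩ := c1
    obtain ⟨n, hn⟩ := c3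
    refine ⟨k ^ 2 - 2 * m * n, ?_⟩
    have e : (2 * (2 * u * v) + c * k) ^ 2 = (c * k) ^ 2 + 4 * (2 * u * v) * (r * t) := by
      rw [show r * t = c * k + 2 * u * v by linarith]; ring
    rw [e]
    have e2 : 4 * (2 * u * v) * (r * t) = -2 * (c * m * (c * n)) := by
      rw [← hm, ← hn]; ring
    linear_combination e2
  have h5 : (c : ℤ) ∣ 2 * (2 * u * v) + c * k := (Int.pow_dvd_pow_iff two_ne_zero).1 h4
  have h6 : (c : ℤ) ∣ 4 * (u * v) := by
    have := (dvd_add_left (dvd_mul_right (c : ℤ) k)).1 h5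
    rwa [show 2 * (2 * u * v) = 4 * (u * v) by ring] at this
  have h7 : (c : ℤ) ∣ 4 * (t * r) := by
    have : 4 * (t * r) = c * k * 4 + (4 * (u * v)) * 2 := by rw [← hk]; ring
    rw [this]
    exact dvd_add ((dvd_mul_right _ _).mul_right _) (h6.mul_right _)
  have h8 : c ∣ 4 * (u * v).natAbs := by
    have := Int.natAbs_dvd_natAbs.2 h6
    rwa [Int.natAbs_mul, Int.natAbs_natCast] at this
  have h9 : c ∣ 4 * (t * r).natAbs := by
    have := Int.natAbs_dvd_natAbs.2 h7
    rwa [Int.natAbs_mul, Int.natAbs_natCast] at this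
  have := Nat.dvd_gcd h8 h9
  rw [Nat.gcd_mul_left] at this
  refine Nat.le_of_dvd ?_ this
  have : 0 < (u * v).natAbs := Int.natAbs_pos.2 (mul_ne_zero hu hv)
  have := Nat.gcd_pos_of_pos_left (t * r).natAbs this
  omega

lemma Adm.exists_factors {V : ℝ} {x : Config} (h : Adm V x) {u v t r : ℤ}
    (e1 : x.s = x.l₁ * u) (e2 : x.s - x.a * x.t = x.l₂ * v) (e3 : x.q = x.l₁ * x.l₂ * r)
    (e4 : x.t = t) :
    ∃ p : ℤ × ℤ × ℤ × ℤ, (x.l₁ = p.1 * p.2.2.1 ∧ x.a - x.b = p.1 * p.2.2.2 ∧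
      x.a + x.b = p.2.2.1 * p.2.1) ∧
      0 < p.1 ∧ 0 < p.2.2.1 ∧ Int.gcd p.1 p.2.1 = 1 ∧ Int.gcd p.2.2.1 p.2.2.2 = 1 ∧
      p.2.1 ≠ 0 ∧ p.2.2.2 ≠ 0 ∧
      (-2 * u * r * p.1 + (r * t - 2 * u * v) * p.2.1) * p.2.2.1 +
        ((r * t - 2 * u * v) * p.1 + 2 * v * t * p.2.1) * p.2.2.2 = 0 := by
  have hd : x.l₁ ∣ (x.a - x.b) * (x.a + x.b) := by
    have := h.dvd₁
    rwa [show x.a ^ 2 - x.b ^ 2 = (x.a - x.b) * (x.a + x.b) by ring] at this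
  obtain ⟨x', z', ⟨w', hw⟩, ⟨y', hy⟩, hl⟩ := exists_dvd_and_dvd_of_dvd_mul hd
  have ha := h.ha
  have hb := h.hb
  have hl0 := h.hl₁
  have hcop := Int.isCoprime_iff_gcd_eq_one.2 h.hab
  obtain ⟨X, Z, Y, W, hX, hZ, hl', hw', hy'⟩ : ∃ X Z Y W : ℤ, 0 < X ∧ 0 < Z ∧ x.l₁ = X * Z ∧
      x.a - x.b = X * W ∧ x.a + x.b = Z * Y := by
    rcases lt_trichotomy x' 0 with hx | hx | hx
    · refine ⟨-x', -z', -y', -w', by omega, ?_, by linarith, by linarith, by linarith⟩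
      rw [hl] at hl0
      nlinarith [neg_of_mul_pos_right hl0 hx.le]
    · rw [hx] at hl; omega
    · exact ⟨x', z', y', w', hx, by rw [hl] at hl0; exact pos_of_mul_pos_right hl0 hx.le,
        hl, hw, hy⟩
  have hodd : Odd (X * Z) := hl' ▸ h.odd₁
  rw [Int.odd_mul] at hodd
  refine ⟨(X, Y, Z, W), ⟨hl', hw', hy'⟩, hX, hZ, ?_, ?_, ?_, ?_, ?_⟩
  · rw [← Int.isCoprime_iff_gcd_eq_one]
    exact isCoprime_odd_dvd hcop hodd.1 ⟨W, hw'⟩ ⟨Z, by rw [hy']; ring⟩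
  · rw [← Int.isCoprime_iff_gcd_eq_one]
    exact isCoprime_odd_dvd (a := x.a) (b := -x.b) hcop.neg_right hodd.2 ⟨Y, by rw [← hy']; ring⟩
      ⟨X, by rw [mul_comm, ← hw']; ring⟩
  · rintro h0
    simp only [] at h0
    rw [h0] at hy'; omega
  · rintro h0
    simp only [] at h0
    rw [h0] at hw'
    exact h.hne (by linarith)
  · have hq : Y * W * t - 2 * x.a * u = x.l₂ * r := by
      have h0 : X * Z ≠ 0 := (mul_pos hX hZ).ne'
      apply mul_left_cancel₀ h0
      rw [Config.q, e4, e1, hl'] at e3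
      have : x.a ^ 2 - x.b ^ 2 = X * W * (Z * Y) := by rw [← hw', ← hy']; ring
      rw [this] at e3
      linear_combination e3
    have h2 : X * Z * u - x.a * t = x.l₂ * v := by rw [← e2, e1, hl', e4]
    have h3 : 2 * x.a = X * W + Z * Y := by linarith
    simp only []
    linear_combination 2 * v * hq - 2 * r * h2 + (2 * u * v - r * t) * h3

lemma card_fixed_quot_le {u v t r : ℤ} {V M R H : ℝ} (hu : u ≠ 0) (hv : v ≠ 0) (ht : t ≠ 0)
    (hr : r ≠ 0) (hM : 1 ≤ M) (hH : DivBound R H) (hMR : 4 * M ≤ R)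
    (hΔR : (((t * r) ^ 2 + 4 * (u * v) ^ 2 : ℤ) : ℝ) ≤ R) (F : Finset Config)
    (hF : ∀ x ∈ F, Adm V x ∧ (x.a : ℝ) ≤ 2 * M ∧ (x.b : ℝ) ≤ 2 * M ∧
      x.s = x.l₁ * u ∧ x.s - x.a * x.t = x.l₂ * v ∧ x.q = x.l₁ * x.l₂ * r ∧ x.t = t) :
    (F.card : ℝ) ≤ 2 * H ^ 3 * (128 * M * ((Nat.gcd (u * v).natAbs (t * r).natAbs : ℝ) /
      (max (u * v).natAbs (t * r).natAbs : ℕ)) + 2) := by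
  have hex : ∀ x : Config, ∃ p : ℤ × ℤ × ℤ × ℤ, x ∈ F → (x.l₁ = p.1 * p.2.2.1 ∧
      x.a - x.b = p.1 * p.2.2.2 ∧ x.a + x.b = p.2.2.1 * p.2.1) ∧
      0 < p.1 ∧ 0 < p.2.2.1 ∧ Int.gcd p.1 p.2.1 = 1 ∧ Int.gcd p.2.2.1 p.2.2.2 = 1 ∧
      p.2.1 ≠ 0 ∧ p.2.2.2 ≠ 0 ∧
      (-2 * u * r * p.1 + (r * t - 2 * u * v) * p.2.1) * p.2.2.1 +
        ((r * t - 2 * u * v) * p.1 + 2 * v * t * p.2.1) * p.2.2.2 = 0 := by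
    intro x
    by_cases hx : x ∈ F
    · obtain ⟨h, -, -, e1, e2, e3, e4⟩ := hF x hx
      obtain ⟨p, hp⟩ := h.exists_factors e1 e2 e3 e4
      exact ⟨p, fun _ => hp⟩
    · exact ⟨0, fun h => absurd h hx⟩
  choose f hf using hex
  have hinj : Set.InjOn f (F : Set Config) := by
    intro x hx y hy hxy
    obtain ⟨⟨x1, x2, x3⟩, -⟩ := hf x hx
    obtain ⟨⟨y1, y2, y3⟩, -⟩ := hf y hy
    obtain ⟨-, -, -, x4, x5, -, x6⟩ := hF x hx
    obtain ⟨-, -, -, y4, y5, -, y6⟩ := hF y hy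
    rw [hxy] at x1 x2 x3
    have ea : x.a = y.a := by linarith
    have el : x.l₁ = y.l₁ := x1.trans y1.symm
    have es : x.s = y.s := by rw [x4, y4, el]
    have et : x.t = y.t := x6.trans y6.symm
    refine Config.ext ea (by linarith) el ?_ es et
    apply mul_right_cancel₀ hv
    rw [← x5, ← y5, ea, es, et]
  have hΔ : (r * t - 2 * u * v) ^ 2 - (-2 * u * r) * (2 * v * t) =
      (t * r) ^ 2 + 4 * (u * v) ^ 2 := by ring
  have huv : 0 < (u * v) ^ 2 := by have := mul_ne_zero hu hv; positivity
  have htr : 0 < (t * r) ^ 2 := by have := mul_ne_zero ht hr; positivity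
  have hΔ0 : 0 < (r * t - 2 * u * v) ^ 2 - (-2 * u * r) * (2 * v * t) := by rw [hΔ]; omega
  have hR1 : 1 ≤ R := by linarith
  have hH1 := hH.one_le hR1
  have key := card_conic_le hΔ0 (N := 4 * M) (by linarith) hH hMR (by rw [hΔ]; exact hΔR)
    (F.image f) ?_
  · rw [Finset.card_image_of_injOn hinj, hΔ] at key
    refine key.trans ?_
    have hg : ((Int.gcd (Int.gcd (-2 * u * r) (r * t - 2 * u * v)) (2 * v * t) : ℕ) : ℝ) ≤
        4 * Nat.gcd (u * v).natAbs (t * r).natAbs := by exact_mod_cast gcd_coeff_le hu hv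
    set g := Int.gcd (Int.gcd (-2 * u * r) (r * t - 2 * u * v)) (2 * v * t)
    have hmax0 : (0 : ℝ) < (max (u * v).natAbs (t * r).natAbs : ℕ) := by
      exact_mod_cast lt_max_of_lt_left (Int.natAbs_pos.2 (mul_ne_zero hu hv))
    have hsq : ((max (u * v).natAbs (t * r).natAbs : ℕ) : ℝ) ≤
        √(((t * r) ^ 2 + 4 * (u * v) ^ 2 : ℤ) : ℝ) := by
      apply Real.le_sqrt_of_sq_le
      rcases max_choice (u * v).natAbs (t * r).natAbs with h | h <;>
      · rw [h, Nat.cast_natAbs]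
        have := @Int.cast_le ℝ
        rw [← Int.cast_pow, Int.cast_le, sq_abs]
        omega
    have : 8 * (g : ℝ) * (4 * M) / √(((t * r) ^ 2 + 4 * (u * v) ^ 2 : ℤ) : ℝ) ≤
        128 * M * ((Nat.gcd (u * v).natAbs (t * r).natAbs : ℝ) /
          (max (u * v).natAbs (t * r).natAbs : ℕ)) := by
      calc _ ≤ 8 * (4 * (Nat.gcd (u * v).natAbs (t * r).natAbs : ℝ)) * (4 * M) /
            (max (u * v).natAbs (t * r).natAbs : ℕ) := by gcongr
        _ = _ := by ring
    gcongr
  · intro p hp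
    obtain ⟨x, hx, rfl⟩ := Finset.mem_image.1 hp
    obtain ⟨⟨x1, x2, x3⟩, p1, p2, p3, p4, p5, p6, p7⟩ := hf x hx
    obtain ⟨h, ha, hb, -⟩ := hF x hx
    have ha0 : (0 : ℝ) < x.a := by exact_mod_cast h.ha
    have hb0 : (0 : ℝ) < x.b := by exact_mod_cast h.hb
    refine ⟨p1, p2, p3, p4, p5, p6, ?_, ?_, p7⟩
    · rw [← Int.cast_mul, ← x3, Int.cast_add, abs_le]
      constructor <;> linarith
    · rw [← Int.cast_mul, ← x2, Int.cast_sub, abs_le]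
      constructor <;> linarith

/-- The quotient `s / λ₁`. -/
def Config.u (x : Config) : ℤ := x.s / x.l₁

/-- The quotient `(s - at) / λ₂`. -/
def Config.v (x : Config) : ℤ := (x.s - x.a * x.t) / x.l₂

/-- The quotient of the linear form `q` by `λ₁λ₂`. -/
def Config.r (x : Config) : ℤ := x.q / (x.l₁ * x.l₂)

lemma Adm.quotients_eq {W : ℝ} {x : Config} (h : Adm W x) :
    x.s = x.l₁ * x.u ∧ x.s - x.a * x.t = x.l₂ * x.v ∧
    x.q = x.l₁ * x.l₂ * x.r ∧ x.u ≠ 0 ∧ x.v ≠ 0 ∧ x.r ≠ 0 ∧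
    |((x.u * x.v : ℤ) : ℝ)| * (max x.a x.b : ℤ) ≤ W ∧
    |((x.t * x.r : ℤ) : ℝ)| * (max x.a x.b : ℤ) ≤ W := by
  obtain ⟨u, v, r, h1, h2, h3, h4⟩ := h.quotients
  have eu : x.u = u := by rw [Config.u, h1, Int.mul_ediv_cancel_left _ h.hl₁.ne']
  have ev : x.v = v := by rw [Config.v, h2, Int.mul_ediv_cancel_left _ h.hl₂.ne']
  have er : x.r = r := by
    rw [Config.r, h3, Int.mul_ediv_cancel_left _ (mul_pos h.hl₁ h.hl₂).ne']
  rw [eu, ev, er]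
  exact ⟨h1, h2, h3, h4⟩

lemma card_fixed_products_le {V M R H : ℝ} {n₁ n₂ : ℕ} (hn₁ : 0 < n₁) (hn₂ : 0 < n₂)
    (hM : 1 ≤ M) (hH : DivBound R H) (hMR : 4 * M ≤ R)
    (hΔR : (n₂ : ℝ) ^ 2 + 4 * (n₁ : ℝ) ^ 2 ≤ R) (F : Finset Config)
    (hF : ∀ x ∈ F, Adm V x ∧ (x.a : ℝ) ≤ 2 * M ∧ (x.b : ℝ) ≤ 2 * M ∧
      (x.u * x.v).natAbs = n₁ ∧ (x.t * x.r).natAbs = n₂) :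
    (F.card : ℝ) ≤ 32 * H ^ 7 * (128 * M * ((Nat.gcd n₁ n₂ : ℝ) / (max n₁ n₂ : ℕ)) + 2) := by
  have hR1 : 1 ≤ R := by linarith
  have hH1 := hH.one_le hR1
  have hc1 : (1 : ℝ) ≤ n₁ := by exact_mod_cast hn₁
  have hc2 : (1 : ℝ) ≤ n₂ := by exact_mod_cast hn₂
  have d1 := hH n₁ hn₁ (by nlinarith)
  have d2 := hH n₂ hn₂ (by nlinarith)
  have i1 : ((intDivisors n₁).card : ℝ) ≤ 2 * H := by
    have : ((intDivisors n₁).card : ℝ) ≤ 2 * n₁.divisors.card := by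
      exact_mod_cast card_intDivisors_le n₁
    linarith
  have i2 : ((intDivisors n₂).card : ℝ) ≤ 2 * H := by
    have : ((intDivisors n₂).card : ℝ) ≤ 2 * n₂.divisors.card := by
      exact_mod_cast card_intDivisors_le n₂
    linarith
  have key := card_le_sum_fiber F (fun x => (x.u, x.v, x.t, x.r))
    (intDivisors n₁ ×ˢ intDivisors n₁ ×ˢ intDivisors n₂ ×ˢ intDivisors n₂)
    (fun _ => 2 * H ^ 3 * (128 * M * ((Nat.gcd n₁ n₂ : ℝ) / (max n₁ n₂ : ℕ)) + 2)) ?_ ?_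
  · refine key.trans ?_
    rw [Finset.sum_const, nsmul_eq_mul, Finset.card_product, Finset.card_product,
      Finset.card_product]
    push_cast
    set E := 128 * M * ((Nat.gcd n₁ n₂ : ℝ) / (max (n₁ : ℝ) n₂)) + 2 with hE
    have hE0 : 0 ≤ E := by positivity
    calc _ ≤ (2 * H) * ((2 * H) * ((2 * H) * (2 * H))) * (2 * H ^ 3 * E) := by gcongr
      _ = _ := by ring
  · intro x hx
    obtain ⟨-, -, -, e1, e2⟩ := hF x hx
    rw [Int.natAbs_mul] at e1 e2
    simp only [Finset.mem_product]
    exact ⟨mem_intDivisors hn₁.ne' (e1 ▸ dvd_mul_right _ _),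
      mem_intDivisors hn₁.ne' (e1 ▸ dvd_mul_left _ _),
      mem_intDivisors hn₂.ne' (e2 ▸ dvd_mul_right _ _),
      mem_intDivisors hn₂.ne' (e2 ▸ dvd_mul_left _ _)⟩
  · rintro ⟨u, v, t, r⟩ -
    set G := F.filter (fun x => (x.u, x.v, x.t, x.r) = (u, v, t, r)) with hG
    have hGm : ∀ x ∈ G, x ∈ F ∧ x.u = u ∧ x.v = v ∧ x.t = t ∧ x.r = r := by
      intro x hx
      simpa only [hG, Finset.mem_filter, Prod.mk.injEq] using hx
    rcases G.eq_empty_or_nonempty with hE | ⟨x₁, hx₁⟩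
    · rw [hE]; simp only [Finset.card_empty, Nat.cast_zero]; positivity
    obtain ⟨hx₁F, e1, e2, e3, e4⟩ := hGm x₁ hx₁
    obtain ⟨h, -, -, f1, f2⟩ := hF x₁ hx₁F
    obtain ⟨-, -, -, u0, v0, r0, -⟩ := h.quotients_eq
    have t0 := h.t0
    rw [e1] at u0
    rw [e2] at v0
    rw [e3] at t0
    rw [e4] at r0
    rw [e1, e2] at f1
    rw [e3, e4] at f2
    rw [← f1, ← f2]
    refine card_fixed_quot_le u0 v0 t0 r0 hM hH hMR ?_ G ?_ (V := V)
    · rw [← Int.natAbs_sq (t * r), ← Int.natAbs_sq (u * v), f1, f2]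
      push_cast
      exact hΔR
    · intro x hx
      obtain ⟨hxF, e1, e2, e3, e4⟩ := hGm x hx
      obtain ⟨h, ha, hb, -⟩ := hF x hxF
      obtain ⟨q1, q2, q3, -⟩ := h.quotients_eq
      rw [e1] at q1
      rw [e2] at q2
      rw [e4] at q3
      exact ⟨h, ha, hb, q1, q2, q3, e3⟩

/-- Points with `max a b` in a dyadic range. -/
lemma card_dyadic_le {A V W M H : ℝ} (hA : 1 ≤ A) (hW : 1 ≤ W)
    (hH : DivBound (8 * A ^ 4 * W ^ 2) H) (hV : 0 ≤ V) (hVW : V ≤ W) (hM : 1 ≤ M) (hMA : M ≤ A)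
    (S : Finset Config)
    (hS : ∀ x ∈ S, Adm V x ∧ M ≤ (max x.a x.b : ℤ) ∧ ((max x.a x.b : ℤ) : ℝ) ≤ 2 * M) :
    (S.card : ℝ) ≤ 8192 * H ^ 8 * (V ^ 2 / M ^ 2 + V) := by
  have hA4 := one_le_pow₀ hA (n := 4)
  have hAA : A ≤ A ^ 4 := le_self_pow₀ hA (by norm_num)
  have hW2 := one_le_pow₀ hW (n := 2)
  have hR1 : 1 ≤ 8 * A ^ 4 * W ^ 2 := by nlinarith
  have hWR : 8 * W ^ 2 ≤ 8 * A ^ 4 * W ^ 2 := by nlinarith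
  have hAR : 8 * A ≤ 8 * A ^ 4 * W ^ 2 := by nlinarith
  have hH1 := hH.one_le hR1
  have hM0 : 0 < M := by linarith
  set N := ⌊V / M⌋₊ with hN
  have hNV : (N : ℝ) ≤ V / M := Nat.floor_le (by positivity)
  have hNV' : (N : ℝ) ≤ V := hNV.trans (div_le_self hV hM)
  have hNM : M * N ≤ V := by rw [mul_comm]; exact (le_div_iff₀ hM0).1 hNV
  have hN2 : (N : ℝ) ^ 2 ≤ V ^ 2 / M ^ 2 := by
    rw [← div_pow]; gcongr
  have hV2 : V ^ 2 ≤ W ^ 2 := by gcongr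
  have hmem : ∀ {n : ℤ} {m : ℝ}, n ≠ 0 → M ≤ m → |(n : ℝ)| * m ≤ V →
      n.natAbs ∈ Finset.Icc 1 N := by
    intro n m hn hm h
    rw [Finset.mem_Icc]
    refine ⟨Int.natAbs_pos.2 hn, Nat.le_floor ?_⟩
    rw [Nat.cast_natAbs, Int.cast_abs, le_div_iff₀ hM0]
    exact le_trans (by gcongr) h
  have key := card_le_sum_fiber S (fun x => ((x.u * x.v).natAbs, (x.t * x.r).natAbs))
    (Finset.Icc 1 N ×ˢ Finset.Icc 1 N)
    (fun n => 32 * H ^ 7 * (128 * M * ((Nat.gcd n.1 n.2 : ℝ) / (max n.1 n.2 : ℕ)) + 2)) ?_ ?_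
  · refine key.trans ?_
    rw [Finset.sum_product]
    have hs := sum_gcd_div_max_le hH (N := N) (by nlinarith)
    calc _ = 32 * H ^ 7 * (128 * M * (∑ n₁ ∈ Finset.Icc 1 N, ∑ n₂ ∈ Finset.Icc 1 N,
          (Nat.gcd n₁ n₂ : ℝ) / (max n₁ n₂ : ℕ)) + 2 * (N : ℝ) ^ 2) := by
          simp only [← Finset.mul_sum, Finset.sum_add_distrib, Finset.sum_const, Nat.card_Icc,
            nsmul_eq_mul, Nat.add_sub_cancel]
          ring
      _ ≤ 32 * H ^ 7 * (128 * M * (2 * N * H) + 2 * (N : ℝ) ^ 2) := by gcongr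
      _ = 32 * H ^ 7 * (256 * H * (M * N) + 2 * (N : ℝ) ^ 2) := by ring
      _ ≤ 32 * H ^ 7 * (256 * H * V + 256 * H * (V ^ 2 / M ^ 2)) := by
          have : 2 * (N : ℝ) ^ 2 ≤ 256 * H * (V ^ 2 / M ^ 2) := by
            have : 0 ≤ V ^ 2 / M ^ 2 := by positivity
            nlinarith
          gcongr
      _ = _ := by ring
  · intro x hx
    obtain ⟨h, hm, -⟩ := hS x hx
    obtain ⟨-, -, -, u0, v0, r0, b1, b2⟩ := h.quotients_eq
    rw [Finset.mem_product]
    exact ⟨hmem (mul_ne_zero u0 v0) hm b1, hmem (mul_ne_zero h.t0 r0) hm b2⟩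
  · rintro ⟨n₁, n₂⟩ hn
    simp only [Finset.mem_product, Finset.mem_Icc] at hn
    obtain ⟨⟨p1, l1⟩, p2, l2⟩ := hn
    have c1 : (n₁ : ℝ) ≤ N := by exact_mod_cast l1
    have c2 : (n₂ : ℝ) ≤ N := by exact_mod_cast l2
    have s1 : (n₁ : ℝ) ^ 2 ≤ V ^ 2 := by have := c1.trans hNV'; gcongr
    have s2 : (n₂ : ℝ) ^ 2 ≤ V ^ 2 := by have := c2.trans hNV'; gcongr
    refine card_fixed_products_le p1 p2 hM hH (by linarith) (by linarith) _ ?_ (V := V)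
    intro x hx
    rw [Finset.mem_filter, Prod.mk.injEq] at hx
    obtain ⟨hx, e1, e2⟩ := hx
    obtain ⟨h, -, hm⟩ := hS x hx
    refine ⟨h, le_trans ?_ hm, le_trans ?_ hm, e1, e2⟩
    · exact_mod_cast le_max_left x.a x.b
    · exact_mod_cast le_max_right x.a x.b

lemma card_small_max_le {A V W H : ℝ} (hA : 1 ≤ A) (hW : 1 ≤ W)
    (hH : DivBound (8 * A ^ 4 * W ^ 2) H) (hV : 0 ≤ V) (hVW : V ≤ W) (S : Finset Config)
    (hS : ∀ x ∈ S, Adm V x ∧ Int.gcd x.s x.t = 1 ∧ ((max x.a x.b : ℤ) : ℝ) ≤ A ∧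
      ((max x.a x.b : ℤ) : ℝ) ^ 2 ≤ V) :
    (S.card : ℝ) ≤ 80 * H ^ 5 * V := by
  have hA4 := one_le_pow₀ hA (n := 4)
  have hW2 := one_le_pow₀ hW (n := 2)
  have hR1 : 1 ≤ 8 * A ^ 4 * W ^ 2 := by nlinarith
  have hWW : W ≤ W ^ 2 := le_self_pow₀ hW (by norm_num)
  have hWR : W ≤ 8 * A ^ 4 * W ^ 2 := by nlinarith
  have hH1 := hH.one_le hR1
  set n := ⌊√V⌋₊ with hn
  have hnV : (n : ℝ) ^ 2 ≤ V := by
    have : (n : ℝ) ≤ √V := Nat.floor_le (Real.sqrt_nonneg V)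
    calc (n : ℝ) ^ 2 ≤ √V ^ 2 := by gcongr
      _ = V := Real.sq_sqrt hV
  have hnn : (n : ℝ) ≤ (n : ℝ) ^ 2 := by
    exact_mod_cast Nat.le_self_pow two_ne_zero n
  have hsum := hH.sum_inv_le hR1 (n := n) (by linarith)
  have hmem : ∀ {c : ℤ} {m : ℝ}, 0 < c → (c : ℝ) ≤ m → m ^ 2 ≤ V →
      c.natAbs ∈ Finset.Icc 1 n := by
    intro c m hc hm h
    rw [Finset.mem_Icc]
    refine ⟨Int.natAbs_pos.2 hc.ne', Nat.le_floor (Real.le_sqrt_of_sq_le ?_)⟩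
    rw [Nat.cast_natAbs, abs_of_pos hc]
    have : (0 : ℝ) < c := by exact_mod_cast hc
    exact le_trans (by gcongr) h
  have key := card_le_sum_fiber S (fun x => (x.a.natAbs, x.b.natAbs))
    (Finset.Icc 1 n ×ˢ Finset.Icc 1 n)
    (fun n => 16 * H ^ 3 * (V / (n.1 * n.2) + 1)) ?_ ?_
  · refine key.trans ?_
    rw [Finset.sum_product]
    calc _ = 16 * H ^ 3 * (V * ((∑ i ∈ Finset.Icc 1 n, (1 : ℝ) / i) *
          (∑ i ∈ Finset.Icc 1 n, (1 : ℝ) / i)) + (n : ℝ) ^ 2) := by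
          have e : ∀ i j : ℕ, 16 * H ^ 3 * (V / ((i : ℝ) * j) + 1) =
              16 * H ^ 3 * (V * (1 / (i : ℝ) * (1 / (j : ℝ))) + 1) := fun i j => by ring
          simp only [e, ← Finset.mul_sum, Finset.sum_add_distrib, Finset.sum_const, Nat.card_Icc,
            nsmul_eq_mul, Nat.add_sub_cancel, ← Finset.sum_mul]
          ring
      _ ≤ 16 * H ^ 3 * (V * ((2 * H) * (2 * H)) + V) := by
          have : 0 ≤ ∑ i ∈ Finset.Icc 1 n, (1 : ℝ) / i := by positivity
          gcongr
      _ ≤ 16 * H ^ 3 * (V * ((2 * H) * (2 * H)) + V * H ^ 2) := by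
          have : V ≤ V * H ^ 2 := le_mul_of_one_le_right hV (one_le_pow₀ hH1)
          gcongr
      _ = _ := by ring
  · intro x hx
    obtain ⟨h, -, -, hm⟩ := hS x hx
    rw [Finset.mem_product]
    refine ⟨hmem h.ha ?_ hm, hmem h.hb ?_ hm⟩
    · exact_mod_cast le_max_left x.a x.b
    · exact_mod_cast le_max_right x.a x.b
  · rintro ⟨m, k⟩ -
    set F := S.filter (fun x => (x.a.natAbs, x.b.natAbs) = (m, k)) with hF
    have hFm : ∀ x ∈ F, Adm V x ∧ Int.gcd x.s x.t = 1 ∧ ((max x.a x.b : ℤ) : ℝ) ≤ A ∧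
        x.a = m ∧ x.b = k := by
      intro x hx
      rw [hF, Finset.mem_filter, Prod.mk.injEq] at hx
      obtain ⟨hx, e1, e2⟩ := hx
      obtain ⟨h, h1, h2, -⟩ := hS x hx
      have := h.ha
      have := h.hb
      exact ⟨h, h1, h2, by omega, by omega⟩
    rcases F.eq_empty_or_nonempty with hE | ⟨x₁, hx₁⟩
    · rw [hE]; simp only [Finset.card_empty, Nat.cast_zero]; positivity
    obtain ⟨h, -, hm, e1, e2⟩ := hFm x₁ hx₁
    have ha := h.ha
    have hb := h.hb
    rw [e1] at ha
    rw [e2] at hb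
    rw [e1, e2] at hm
    have := card_fixed_ab_le hA hW hH hV hVW ha hb
      (le_trans (by exact_mod_cast le_max_left (m : ℤ) (k : ℤ)) hm)
      (le_trans (by exact_mod_cast le_max_right (m : ℤ) (k : ℤ)) hm) F
      (fun x hx => ⟨(hFm x hx).1, (hFm x hx).2.1, (hFm x hx).2.2.2⟩)
    simpa only [Int.cast_natCast] using this

lemma card_large_max_le {A V W H : ℝ} (hA : 1 ≤ A) (hW : 1 ≤ W)
    (hH : DivBound (8 * A ^ 4 * W ^ 2) H) (hV : 0 ≤ V) (hVW : V ≤ W) (S : Finset Config)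
    (hS : ∀ x ∈ S, Adm V x ∧ ((max x.a x.b : ℤ) : ℝ) ≤ A ∧
      V ≤ ((max x.a x.b : ℤ) : ℝ) ^ 2) :
    (S.card : ℝ) ≤ 40960 * H ^ 9 * V := by
  have hA4 := one_le_pow₀ hA (n := 4)
  have hAA : A ≤ A ^ 4 := le_self_pow₀ hA (by norm_num)
  have hW2 := one_le_pow₀ hW (n := 2)
  have hR1 : 1 ≤ 8 * A ^ 4 * W ^ 2 := by nlinarith
  have hAR : A ≤ 8 * A ^ 4 * W ^ 2 := by nlinarith
  have hH1 := hH.one_le hR1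
  have hfl : (⌊A⌋₊ : ℝ) ≤ A := Nat.floor_le (by linarith)
  have hlog := hH.log_succ_le (n := ⌊A⌋₊) (Nat.floor_pos.2 hA) (hfl.trans hAR)
  have hle : ∀ x ∈ S, (max x.a x.b).natAbs ≤ ⌊A⌋₊ := by
    intro x hx
    obtain ⟨h, hm, -⟩ := hS x hx
    apply Nat.le_floor
    rw [Nat.cast_natAbs, abs_of_pos (lt_max_of_lt_left h.ha)]
    exact hm
  have key := card_le_sum_fiber S (fun x => Nat.log 2 (max x.a x.b).natAbs)
    (Finset.range (Nat.log 2 ⌊A⌋₊ + 1)) (fun _ => 8192 * H ^ 8 * (4 * V + V)) ?_ ?_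
  · refine key.trans ?_
    rw [Finset.sum_const, nsmul_eq_mul, Finset.card_range]
    calc _ ≤ H * (8192 * H ^ 8 * (4 * V + V)) := by gcongr
      _ = _ := by ring
  · intro x hx
    rw [Finset.mem_range]
    have := Nat.log_mono_right (b := 2) (hle x hx)
    omega
  · intro j hj
    set F := S.filter (fun x => Nat.log 2 (max x.a x.b).natAbs = j) with hF
    rcases F.eq_empty_or_nonempty with hE | ⟨x₁, hx₁⟩
    · rw [hE]; simp only [Finset.card_empty, Nat.cast_zero]; positivity
    have hM1 : (1 : ℝ) ≤ 2 ^ j := one_le_pow₀ (by norm_num)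
    have hFm : ∀ x ∈ F, Adm V x ∧ (2 : ℝ) ^ j ≤ (max x.a x.b : ℤ) ∧
        ((max x.a x.b : ℤ) : ℝ) ≤ 2 * 2 ^ j := by
      intro x hx
      rw [hF, Finset.mem_filter] at hx
      obtain ⟨hx, e⟩ := hx
      obtain ⟨h, -⟩ := hS x hx
      have hp : 0 < max x.a x.b := lt_max_of_lt_left h.ha
      have h1 := two_pow_log_le_abs hp.ne'
      have h2 := abs_lt_two_pow_log (max x.a x.b)
      rw [e, abs_of_pos (by exact_mod_cast hp)] at h1 h2
      exact ⟨h, h1, h2.le⟩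
    obtain ⟨h, g1, g2⟩ := hFm x₁ hx₁
    obtain ⟨-, g3, g4⟩ := hS x₁ (Finset.filter_subset _ _ hx₁)
    refine (card_dyadic_le hA hW hH hV hVW hM1 (g1.trans g3) F hFm).trans ?_
    have hp := h.max_pos
    have : V ^ 2 / (2 ^ j) ^ 2 ≤ 4 * V := by
      rw [div_le_iff₀ (by positivity)]
      have : V ≤ 4 * (2 ^ j) ^ 2 := by nlinarith
      nlinarith
    gcongr

/-- Points with `s`, `t` coprime. -/
lemma card_coprime_le {A V W H : ℝ} (hA : 1 ≤ A) (hW : 1 ≤ W)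
    (hH : DivBound (8 * A ^ 4 * W ^ 2) H) (hV : 0 ≤ V) (hVW : V ≤ W) (S : Finset Config)
    (hS : ∀ x ∈ S, Adm V x ∧ Int.gcd x.s x.t = 1 ∧ ((max x.a x.b : ℤ) : ℝ) ≤ A) :
    (S.card : ℝ) ≤ 41040 * H ^ 9 * V := by
  have hA4 := one_le_pow₀ hA (n := 4)
  have hW2 := one_le_pow₀ hW (n := 2)
  have hR1 : 1 ≤ 8 * A ^ 4 * W ^ 2 := by nlinarith
  have hH1 := hH.one_le hR1
  have h1 := card_small_max_le hA hW hH hV hVW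
    (S.filter (fun x => ((max x.a x.b : ℤ) : ℝ) ^ 2 ≤ V)) (by
      intro x hx
      rw [Finset.mem_filter] at hx
      obtain ⟨p, q, r⟩ := hS x hx.1
      exact ⟨p, q, r, hx.2⟩)
  have h2 := card_large_max_le hA hW hH hV hVW
    (S.filter (fun x => ¬ ((max x.a x.b : ℤ) : ℝ) ^ 2 ≤ V)) (by
      intro x hx
      rw [Finset.mem_filter] at hx
      obtain ⟨p, q, r⟩ := hS x hx.1
      exact ⟨p, r, (not_le.1 hx.2).le⟩)
  rw [← Finset.card_filter_add_card_filter_not (s := S) (fun x => ((max x.a x.b : ℤ) : ℝ) ^ 2 ≤ V)]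
  rw [Nat.cast_add]
  have : H ^ 5 * V ≤ H ^ 9 * V := by
    have : H ^ 5 ≤ H ^ 9 := pow_le_pow_right₀ hH1 (by norm_num)
    gcongr
  linarith

/-- `y` is obtained from `x` by removing the common factor `m * g₁ * g₂` of `s` and `t`,
where `gᵢ` is the part shared with `λᵢ`. -/
structure IsReduction (W : ℝ) (x : Config) (m g₁ g₂ : ℕ) (y : Config) : Prop where
  hm : 0 < m
  hg₁ : 0 < g₁
  hg₂ : 0 < g₂
  gcd_eq : Int.gcd x.s x.t = m * g₁ * g₂
  a_eq : x.a = y.a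
  b_eq : x.b = y.b
  l₁_eq : x.l₁ = g₁ * y.l₁
  l₂_eq : x.l₂ = g₂ * y.l₂
  s_eq : x.s = m * g₁ * g₂ * y.s
  t_eq : x.t = m * g₁ * g₂ * y.t
  adm : Adm (W / (m ^ 2 * g₁ * g₂)) y
  cop : Int.gcd y.s y.t = 1

lemma dvd_of_mul_dvd_mul_of_gcd {l l' d e s : ℤ} {g : ℕ} (hg : g ≠ 0) (hl : l = g * l')
    (hd : d = g * e) (h : Int.gcd l d = g) (hs : l ∣ d * s) : l' ∣ s := by
  have hg0 : (g : ℤ) ≠ 0 := by exact_mod_cast hg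
  have hc : Int.gcd l' e = 1 := by
    rw [hl, hd, Int.gcd_mul_left, Int.natAbs_natCast] at h
    exact Nat.eq_of_mul_eq_mul_left (Nat.pos_of_ne_zero hg) (by rw [h, mul_one])
  rw [hl, hd, mul_assoc] at hs
  exact (Int.isCoprime_iff_gcd_eq_one.2 hc).dvd_of_dvd_mul_left (Int.dvd_of_mul_dvd_mul_left hg0 hs)

lemma Adm.exists_reduction {W : ℝ} {x : Config} (h : Adm W x) :
    ∃ p : ℕ × ℕ × ℕ × Config, IsReduction W x p.1 p.2.1 p.2.2.1 p.2.2.2 := by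
  set d := Int.gcd x.s x.t with hd
  have hd0 : 0 < d := Int.gcd_pos_of_ne_zero_left _ h.s0
  obtain ⟨s', hs⟩ : (d : ℤ) ∣ x.s := Int.gcd_dvd_left ..
  obtain ⟨t', ht⟩ : (d : ℤ) ∣ x.t := Int.gcd_dvd_right ..
  have hcop : Int.gcd s' t' = 1 := by
    have : d = d * Int.gcd s' t' := by
      conv_lhs => rw [hd, hs, ht, Int.gcd_mul_left, Int.natAbs_natCast]
    exact Nat.eq_of_mul_eq_mul_left hd0 (by rw [← this, mul_one])
  set g₁ := Int.gcd x.l₁ d with hg₁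
  set g₂ := Int.gcd x.l₂ d with hg₂
  have hg₁0 : 0 < g₁ := Int.gcd_pos_of_ne_zero_left _ h.hl₁.ne'
  have hg₂0 : 0 < g₂ := Int.gcd_pos_of_ne_zero_left _ h.hl₂.ne'
  obtain ⟨l₁', hl₁⟩ : (g₁ : ℤ) ∣ x.l₁ := Int.gcd_dvd_left ..
  obtain ⟨l₂', hl₂⟩ : (g₂ : ℤ) ∣ x.l₂ := Int.gcd_dvd_left ..
  have hgc : Nat.Coprime g₁ g₂ := by
    have := (h.isCoprime.of_isCoprime_of_dvd_left ⟨l₁', hl₁⟩).of_isCoprime_of_dvd_right ⟨l₂', hl₂⟩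
    exact Nat.isCoprime_iff_coprime.1 this
  have hdg : g₁ * g₂ ∣ d := by
    refine hgc.mul_dvd_of_dvd_of_dvd ?_ ?_
    · exact Int.natCast_dvd_natCast.1 (Int.gcd_dvd_right ..)
    · exact Int.natCast_dvd_natCast.1 (Int.gcd_dvd_right ..)
  obtain ⟨m, hm⟩ := hdg
  have hm0 : 0 < m := Nat.pos_of_ne_zero (by rintro rfl; omega)
  have hm' : (d : ℤ) = g₁ * (g₂ * m) := by rw [hm]; push_cast; ring
  have hm'' : (d : ℤ) = g₂ * (g₁ * m) := by rw [hm]; push_cast; ring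
  have hdZ : (0 : ℤ) < d := by exact_mod_cast hd0
  have hg₁Z : (0 : ℤ) < g₁ := by exact_mod_cast hg₁0
  have hg₂Z : (0 : ℤ) < g₂ := by exact_mod_cast hg₂0
  have hsub : x.s - x.a * x.t = d * (s' - x.a * t') := by rw [hs, ht]; ring
  have hq : x.q = d * ((x.a ^ 2 - x.b ^ 2) * t' - 2 * x.a * s') := by rw [Config.q, hs, ht]; ring
  have hl₁p := h.hl₁
  have hl₂p := h.hl₂
  rw [hl₁] at hl₁p
  rw [hl₂] at hl₂p
  have o₁ := h.odd₁
  have o₂ := h.odd₂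
  rw [hl₁, Int.odd_mul] at o₁
  rw [hl₂, Int.odd_mul] at o₂
  have d₁ := h.dvds₁
  have d₂ := h.dvds₂
  rw [hs] at d₁
  rw [hsub] at d₂
  have hdR : (d : ℝ) = m * g₁ * g₂ := by rw [hm]; push_cast; ring
  have hmR : (0 : ℝ) < m := by exact_mod_cast hm0
  have hg₁R : (0 : ℝ) < g₁ := by exact_mod_cast hg₁0
  have hg₂R : (0 : ℝ) < g₂ := by exact_mod_cast hg₂0
  have scale : ∀ n k : ℤ, n = d ^ 2 * k →
      |(n : ℝ)| * (max x.a x.b : ℤ) ≤ x.l₁ * x.l₂ * W →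
      |(k : ℝ)| * (max x.a x.b : ℤ) ≤ l₁' * l₂' * (W / (m ^ 2 * g₁ * g₂)) := by
    intro n k hn hb
    rw [hn, hl₁, hl₂] at hb
    push_cast at hb
    rw [abs_mul, abs_of_nonneg (by positivity), hdR] at hb
    rw [← mul_div_assoc, le_div_iff₀ (by positivity)]
    push_cast
    refine le_of_mul_le_mul_left ?_ (mul_pos hg₁R hg₂R)
    calc _ = (m * g₁ * g₂) ^ 2 * |(k : ℝ)| * max (x.a : ℝ) x.b := by ring
      _ ≤ _ := hb
      _ = _ := by ring
  refine ⟨(m, g₁, g₂, ⟨x.a, x.b, l₁', l₂', s', t'⟩), hm0, hg₁0, hg₂0, ?_, rfl, rfl, hl₁, hl₂,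
    ?_, ?_, ?_, hcop⟩
  · simp only []
    rw [← hd, hm]; ring
  · simp only []
    rw [hs, hm]; push_cast; ring
  · simp only []
    rw [ht, hm]; push_cast; ring
  · refine ⟨h.ha, h.hb, h.hab, h.hne, pos_of_mul_pos_right hl₁p hg₁Z.le,
      pos_of_mul_pos_right hl₂p hg₂Z.le, o₁.2, o₂.2, ?_, ?_, ?_, ?_, ?_, ?_, ?_, ?_, ?_, ?_⟩
    · exact dvd_trans (Dvd.intro_left _ hl₁.symm) h.dvd₁
    · exact dvd_trans (Dvd.intro_left _ hl₂.symm) h.dvd₂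
    · exact dvd_of_mul_dvd_mul_of_gcd hg₁0.ne' hl₁ hm' rfl d₁
    · exact dvd_of_mul_dvd_mul_of_gcd hg₂0.ne' hl₂ hm'' rfl d₂
    · rintro h0
      exact h.s0 (by rw [hs, show s' = 0 from h0, mul_zero])
    · rintro h0
      exact h.t0 (by rw [ht, show t' = 0 from h0, mul_zero])
    · rintro h0
      exact h.v0 (by rw [hsub, show s' - x.a * t' = 0 from h0, mul_zero])
    · rintro h0
      exact h.q0 (by rw [hq, show (x.a ^ 2 - x.b ^ 2) * t' - 2 * x.a * s' = 0 from h0, mul_zero])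
    · refine scale _ _ ?_ h.bd₁
      simp only []
      rw [hsub, hs]; ring
    · refine scale _ _ ?_ h.bd₂
      rw [hq, ht]
      simp only [Config.q]
      ring

namespace IsReduction

variable {W : ℝ} {x y : Config} {m g₁ g₂ : ℕ}

lemma le (h : IsReduction W x m g₁ g₂ y) : (m : ℝ) ^ 2 * g₁ * g₂ ≤ W := by
  have h1 := h.adm.max_le
  have h2 : (1 : ℝ) ≤ (max y.a y.b : ℤ) := by
    exact_mod_cast (lt_max_of_lt_left h.adm.ha : 0 < max y.a y.b)
  have h3 := h.hm
  have h4 := h.hg₁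
  have h5 := h.hg₂
  have := h2.trans h1
  rwa [le_div_iff₀ (by positivity), one_mul] at this

lemma injective {x' : Config} (h : IsReduction W x m g₁ g₂ y) (h' : IsReduction W x' m g₁ g₂ y) :
    x = x' :=
  Config.ext (h.a_eq.trans h'.a_eq.symm) (h.b_eq.trans h'.b_eq.symm) (h.l₁_eq.trans h'.l₁_eq.symm)
    (h.l₂_eq.trans h'.l₂_eq.symm) (h.s_eq.trans h'.s_eq.symm) (h.t_eq.trans h'.t_eq.symm)

end IsReduction

lemma sum_inv_sq_le {T : ℝ} (hT : 0 < T) (n : ℕ) :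
    ∑ m ∈ Finset.Ioo ⌊T⌋₊ n, (1 : ℝ) / (m : ℝ) ^ 2 ≤ 2 / T := by
  have h := sum_Ioo_inv_sq_le (α := ℝ) ⌊T⌋₊ n
  simp only [one_div]
  refine h.trans (div_le_div_of_nonneg_left (by norm_num) hT ?_)
  exact (Nat.lt_floor_add_one T).le

lemma card_reduction_le {W : ℝ} {m g₁ g₂ : ℕ} {f : Config → ℕ × ℕ × ℕ × Config} (F : Finset Config)
    (hf : ∀ x ∈ F, IsReduction W x (f x).1 (f x).2.1 (f x).2.2.1 (f x).2.2.2 ∧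
      (f x).1 = m ∧ (f x).2.1 = g₁ ∧ (f x).2.2.1 = g₂) :
    F.card = (F.image (fun x => (f x).2.2.2)).card ∧
      ∀ y ∈ F.image (fun x => (f x).2.2.2), ∃ x ∈ F, IsReduction W x m g₁ g₂ y := by
  have hred : ∀ x ∈ F, IsReduction W x m g₁ g₂ (f x).2.2.2 := by
    intro x hx
    obtain ⟨h, e1, e2, e3⟩ := hf x hx
    rwa [e1, e2, e3] at h
  constructor
  · rw [Finset.card_image_of_injOn]
    intro x hx y hy hxy
    have h1 := hred x hx
    have h2 := hred y hy
    simp only [] at hxy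
    rw [hxy] at h1
    exact h1.injective h2
  · intro y hy
    obtain ⟨x, hx, rfl⟩ := Finset.mem_image.1 hy
    exact ⟨x, hx, hred x hx⟩

lemma le_floor_of_pow_mul_le {W : ℝ} {m g₁ g₂ : ℕ} (hm : 0 < m) (h₁ : 0 < g₁) (h₂ : 0 < g₂)
    (h : (m : ℝ) ^ 2 * g₁ * g₂ ≤ W) : m ≤ ⌊W⌋₊ ∧ g₁ ≤ ⌊W⌋₊ ∧ g₂ ≤ ⌊W⌋₊ ∧ m * g₁ * g₂ ≤ ⌊W⌋₊ := by
  have h0 : m ^ 2 * g₁ * g₂ ≤ ⌊W⌋₊ := Nat.le_floor (by exact_mod_cast h)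
  have hmm : m ≤ m ^ 2 := Nat.le_self_pow two_ne_zero m
  have h3 : m * g₁ * g₂ ≤ m ^ 2 * g₁ * g₂ := by gcongr
  have h4 := h3.trans h0
  refine ⟨le_trans ?_ h4, le_trans ?_ h4, le_trans ?_ h4, h4⟩
  · rw [mul_assoc]; exact Nat.le_mul_of_pos_right _ (Nat.mul_pos h₁ h₂)
  · rw [mul_right_comm]; exact Nat.le_mul_of_pos_left _ (Nat.mul_pos hm h₂)
  · exact Nat.le_mul_of_pos_left _ (Nat.mul_pos hm h₁)

/-- Points for which the free part of `gcd(s, t)` exceeds `T`. -/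
lemma card_large_free_part_le {A W T H : ℝ} (hA : 1 ≤ A) (hW : 1 ≤ W) (hT : 0 < T)
    (hH : DivBound (8 * A ^ 4 * W ^ 2) H) {f : Config → ℕ × ℕ × ℕ × Config} (S : Finset Config)
    (hS : ∀ x ∈ S, ((max x.a x.b : ℤ) : ℝ) ≤ A ∧ T < (f x).1 ∧
      IsReduction W x (f x).1 (f x).2.1 (f x).2.2.1 (f x).2.2.2) :
    (S.card : ℝ) ≤ 328320 * H ^ 11 * (W / T) := by
  have hA4 := one_le_pow₀ hA (n := 4)
  have hW2 := one_le_pow₀ hW (n := 2)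
  have hR1 : 1 ≤ 8 * A ^ 4 * W ^ 2 := by nlinarith
  have hWW : W ≤ W ^ 2 := le_self_pow₀ hW (by norm_num)
  have hWR : W ≤ 8 * A ^ 4 * W ^ 2 := by nlinarith
  have hH1 := hH.one_le hR1
  set n := ⌊W⌋₊ with hn
  have hnW : (n : ℝ) ≤ W := Nat.floor_le (by linarith)
  have hsum := hH.sum_inv_le hR1 (hnW.trans hWR)
  have hsq := sum_inv_sq_le hT (n + 1)
  have key := card_le_sum_fiber S (fun x => ((f x).1, (f x).2.1, (f x).2.2.1))
    (Finset.Ioo ⌊T⌋₊ (n + 1) ×ˢ Finset.Icc 1 n ×ˢ Finset.Icc 1 n)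
    (fun p => 41040 * H ^ 9 * (W / (p.1 ^ 2 * p.2.1 * p.2.2))) ?_ ?_
  · refine key.trans ?_
    rw [Finset.sum_product]
    simp only [Finset.sum_product]
    calc _ = 41040 * H ^ 9 * W * ((∑ m ∈ Finset.Ioo ⌊T⌋₊ (n + 1), (1 : ℝ) / (m : ℝ) ^ 2) *
          ((∑ i ∈ Finset.Icc 1 n, (1 : ℝ) / i) * (∑ i ∈ Finset.Icc 1 n, (1 : ℝ) / i))) := by
          have e : ∀ m i j : ℕ, 41040 * H ^ 9 * (W / ((m : ℝ) ^ 2 * i * j)) =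
              41040 * H ^ 9 * W * (1 / (m : ℝ) ^ 2 * (1 / (i : ℝ) * (1 / (j : ℝ)))) :=
            fun m i j => by ring
          simp only [e, ← Finset.mul_sum, ← Finset.sum_mul]
      _ ≤ 41040 * H ^ 9 * W * (2 / T * ((2 * H) * (2 * H))) := by
          have : 0 ≤ ∑ i ∈ Finset.Icc 1 n, (1 : ℝ) / i := by positivity
          gcongr
      _ = _ := by ring
  · intro x hx
    obtain ⟨-, ht, h⟩ := hS x hx
    obtain ⟨b1, b2, b3, -⟩ := le_floor_of_pow_mul_le h.hm h.hg₁ h.hg₂ h.le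
    simp only [Finset.mem_product, Finset.mem_Icc, Finset.mem_Ioo]
    exact ⟨⟨(Nat.floor_lt hT.le).2 ht, by omega⟩, ⟨h.hg₁, b2⟩, h.hg₂, b3⟩
  · rintro ⟨m, g₁, g₂⟩ -
    set F := S.filter (fun x => ((f x).1, (f x).2.1, (f x).2.2.1) = (m, g₁, g₂)) with hF
    have hFm : ∀ x ∈ F, x ∈ S ∧ (f x).1 = m ∧ (f x).2.1 = g₁ ∧ (f x).2.2.1 = g₂ := by
      intro x hx
      simpa only [hF, Finset.mem_filter, Prod.mk.injEq] using hx
    obtain ⟨hc, hy⟩ := card_reduction_le (W := W) (m := m) (g₁ := g₁) (g₂ := g₂) (f := f) F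
      (fun x hx => ⟨(hS x (hFm x hx).1).2.2, (hFm x hx).2⟩)
    rcases F.eq_empty_or_nonempty with hE | ⟨x₁, hx₁⟩
    · rw [hE]; simp only [Finset.card_empty, Nat.cast_zero]; positivity
    obtain ⟨hx₁, e1, e2, e3⟩ := hFm x₁ hx₁
    have h := (hS x₁ hx₁).2.2
    rw [e1, e2, e3] at h
    have hpos : 1 ≤ (m : ℝ) ^ 2 * g₁ * g₂ := by
      have : 0 < m ^ 2 * g₁ * g₂ := by
        have := h.hm; have := h.hg₁; have := h.hg₂; positivity
      exact_mod_cast this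
    rw [hc]
    refine card_coprime_le hA hW hH (by positivity) (div_le_self (by linarith) hpos) _ ?_
    intro y hyF
    obtain ⟨x, hx, hr⟩ := hy y hyF
    refine ⟨hr.adm, hr.cop, ?_⟩
    rw [← hr.a_eq, ← hr.b_eq]
    exact (hS x (hFm x hx).1).1

lemma card_fixed_ab_gcds_le {a b : ℤ} {A W T H : ℝ} {g₁ g₂ : ℕ} (hA : 1 ≤ A) (hW : 1 ≤ W)
    (hT : 0 < T) (hH : DivBound (8 * A ^ 4 * W ^ 2) H)
    (ha : 0 < a) (hb : 0 < b) (haA : (a : ℝ) ≤ A) (hbA : (b : ℝ) ≤ A)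
    (hg₁ : 0 < g₁) (hg₂ : 0 < g₂)
    {f : Config → ℕ × ℕ × ℕ × Config} (S : Finset Config)
    (hS : ∀ x ∈ S, x.a = a ∧ x.b = b ∧ (f x).2.1 = g₁ ∧ (f x).2.2.1 = g₂ ∧
      T < (f x).1 * g₁ * g₂ ∧ ((f x).1 : ℝ) ≤ T ∧
      IsReduction W x (f x).1 (f x).2.1 (f x).2.2.1 (f x).2.2.2) :
    (S.card : ℝ) ≤ 16 * H ^ 3 * (2 * W / T * (1 / (a * b)) + ⌊T⌋₊) := by
  have haR : (0 : ℝ) < a := by exact_mod_cast ha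
  have hbR : (0 : ℝ) < b := by exact_mod_cast hb
  have hA4 := one_le_pow₀ hA (n := 4)
  have hW2 := one_le_pow₀ hW (n := 2)
  have hR1 : 1 ≤ 8 * A ^ 4 * W ^ 2 := by nlinarith
  have hH1 := hH.one_le hR1
  have hg₁R : (0 : ℝ) < g₁ := by exact_mod_cast hg₁
  have hg₂R : (0 : ℝ) < g₂ := by exact_mod_cast hg₂
  set T' := T / (g₁ * g₂) with hT'
  have hT'0 : 0 < T' := by positivity
  have hsq := sum_inv_sq_le hT'0 (⌊T⌋₊ + 1)
  have key := card_le_sum_fiber S (fun x => (f x).1) (Finset.Ioo ⌊T'⌋₊ (⌊T⌋₊ + 1))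
    (fun m => 16 * H ^ 3 * (W / (m ^ 2 * g₁ * g₂) / (a * b) + 1)) ?_ ?_
  · refine key.trans ?_
    have hcard : ((Finset.Ioo ⌊T'⌋₊ (⌊T⌋₊ + 1)).card : ℝ) ≤ ⌊T⌋₊ := by
      rw [Nat.card_Ioo]
      exact_mod_cast (by omega : ⌊T⌋₊ + 1 - ⌊T'⌋₊ - 1 ≤ ⌊T⌋₊)
    calc _ = 16 * H ^ 3 * (W / (g₁ * g₂) * (1 / (a * b)) *
          (∑ m ∈ Finset.Ioo ⌊T'⌋₊ (⌊T⌋₊ + 1), (1 : ℝ) / (m : ℝ) ^ 2) +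
          (Finset.Ioo ⌊T'⌋₊ (⌊T⌋₊ + 1)).card) := by
          have e : ∀ m : ℕ, 16 * H ^ 3 * (W / ((m : ℝ) ^ 2 * g₁ * g₂) / (a * b) + 1) =
              16 * H ^ 3 * (W / (g₁ * g₂) * (1 / (a * b)) * (1 / (m : ℝ) ^ 2) + 1) :=
            fun m => by ring
          simp only [e, ← Finset.mul_sum, Finset.sum_add_distrib, Finset.sum_const,
            nsmul_eq_mul, mul_one]
      _ ≤ 16 * H ^ 3 * (W / (g₁ * g₂) * (1 / (a * b)) * (2 / T') + ⌊T⌋₊) := by gcongr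
      _ = _ := by
          rw [hT']
          field_simp
  · intro x hx
    obtain ⟨-, -, -, -, h1, h2, -⟩ := hS x hx
    rw [Finset.mem_Ioo, Nat.floor_lt hT'0.le, hT', div_lt_iff₀ (by positivity)]
    refine ⟨by rwa [← mul_assoc], ?_⟩
    have := Nat.le_floor h2
    omega
  · rintro m -
    set F := S.filter (fun x => (f x).1 = m) with hF
    have hFm : ∀ x ∈ F, x ∈ S ∧ (f x).1 = m := by
      intro x hx
      simpa only [hF, Finset.mem_filter] using hx
    obtain ⟨hc, hy⟩ := card_reduction_le (W := W) (m := m) (g₁ := g₁) (g₂ := g₂) (f := f) F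
      (fun x hx => by
        obtain ⟨-, -, e1, e2, -, -, h⟩ := hS x (hFm x hx).1
        exact ⟨h, (hFm x hx).2, e1, e2⟩)
    rcases F.eq_empty_or_nonempty with hE | ⟨x₁, hx₁⟩
    · rw [hE]; simp only [Finset.card_empty, Nat.cast_zero]; positivity
    obtain ⟨hx₁, e1⟩ := hFm x₁ hx₁
    obtain ⟨-, -, e2, e3, -, -, h⟩ := hS x₁ hx₁
    rw [e1, e2, e3] at h
    have hpos : 1 ≤ (m : ℝ) ^ 2 * g₁ * g₂ := by
      have : 0 < m ^ 2 * g₁ * g₂ := by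
        have := h.hm; positivity
      exact_mod_cast this
    rw [hc]
    refine card_fixed_ab_le hA hW hH (by positivity) (div_le_self (by linarith) hpos)
      ha hb haA hbA _ ?_
    intro y hyF
    obtain ⟨x, hx, hr⟩ := hy y hyF
    obtain ⟨p1, p2, -⟩ := hS x (hFm x hx).1
    exact ⟨hr.adm, hr.cop, hr.a_eq ▸ p1, hr.b_eq ▸ p2⟩

lemma card_fixed_ab_small_free_part_le {a b : ℤ} {A W T H : ℝ} (hA : 1 ≤ A) (hW : 1 ≤ W)
    (hT : 0 < T) (hH : DivBound (8 * A ^ 4 * W ^ 2) H)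
    (ha : 0 < a) (hb : 0 < b) (haA : (a : ℝ) ≤ A) (hbA : (b : ℝ) ≤ A)
    {f : Config → ℕ × ℕ × ℕ × Config} (S : Finset Config)
    (hS : ∀ x ∈ S, x.a = a ∧ x.b = b ∧ Adm W x ∧ T < (Int.gcd x.s x.t : ℝ) ∧ ((f x).1 : ℝ) ≤ T ∧
      IsReduction W x (f x).1 (f x).2.1 (f x).2.2.1 (f x).2.2.2) :
    (S.card : ℝ) ≤ 16 * H ^ 5 * (2 * W / T * (1 / (a * b)) + ⌊T⌋₊) := by
  have haR : (0 : ℝ) < a := by exact_mod_cast ha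
  have hbR : (0 : ℝ) < b := by exact_mod_cast hb
  have hA4 := one_le_pow₀ hA (n := 4)
  have hW2 := one_le_pow₀ hW (n := 2)
  have hR1 : 1 ≤ 8 * A ^ 4 * W ^ 2 := by nlinarith
  have hH1 := hH.one_le hR1
  rcases S.eq_empty_or_nonempty with rfl | ⟨x₀, hx₀⟩
  · simp only [Finset.card_empty, Nat.cast_zero]; positivity
  obtain ⟨ea, eb, h0, -⟩ := hS x₀ hx₀
  have hne : a ^ 2 - b ^ 2 ≠ 0 := by have := h0.sub_ne_zero; rwa [ea, eb] at this
  have hpos : 0 < a ^ 2 + b ^ 2 := by positivity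
  have ha2 : (a : ℝ) ^ 2 ≤ A ^ 2 := by gcongr
  have hb2 : (b : ℝ) ^ 2 ≤ A ^ 2 := by gcongr
  have hR2 : 2 * A ^ 2 ≤ 8 * A ^ 4 * W ^ 2 := by
    have : A ^ 2 ≤ A ^ 4 := pow_le_pow_right₀ hA (by norm_num)
    nlinarith
  have t1 : ((a ^ 2 - b ^ 2).natAbs.divisors.card : ℝ) ≤ H := by
    apply hH _ (Int.natAbs_pos.2 hne)
    rw [Nat.cast_natAbs, Int.cast_abs]
    push_cast
    refine (abs_le.2 ⟨?_, ?_⟩ : _ ≤ A ^ 2).trans ?_ <;> nlinarith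
  have t2 : ((a ^ 2 + b ^ 2).natAbs.divisors.card : ℝ) ≤ H := by
    apply hH _ (Int.natAbs_pos.2 hpos.ne')
    rw [Nat.cast_natAbs, Int.cast_abs]
    push_cast
    refine (abs_le.2 ⟨?_, ?_⟩ : _ ≤ 2 * A ^ 2).trans ?_ <;> nlinarith
  set E := 2 * W / T * (1 / (a * b)) + ⌊T⌋₊ with hE
  have hE0 : 0 ≤ E := by positivity
  have key := card_le_sum_fiber S (fun x => ((f x).2.1, (f x).2.2.1))
    ((a ^ 2 - b ^ 2).natAbs.divisors ×ˢ (a ^ 2 + b ^ 2).natAbs.divisors)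
    (fun _ => 16 * H ^ 3 * E) ?_ ?_
  · refine key.trans ?_
    rw [Finset.sum_const, nsmul_eq_mul, Finset.card_product, Nat.cast_mul]
    calc _ ≤ H * H * (16 * H ^ 3 * E) := by gcongr
      _ = _ := by ring
  · intro x hx
    obtain ⟨ea, eb, h, -, -, hr⟩ := hS x hx
    have d1 := (Dvd.intro _ hr.l₁_eq.symm).trans h.dvd₁
    have d2 := (Dvd.intro _ hr.l₂_eq.symm).trans h.dvd₂
    rw [ea, eb] at d1 d2
    rw [Finset.mem_product, Nat.mem_divisors, Nat.mem_divisors]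
    exact ⟨⟨Int.natCast_dvd.1 d1, Int.natAbs_ne_zero.2 hne⟩,
      ⟨Int.natCast_dvd.1 d2, Int.natAbs_ne_zero.2 hpos.ne'⟩⟩
  · rintro ⟨g₁, g₂⟩ hg
    rw [Finset.mem_product] at hg
    refine card_fixed_ab_gcds_le hA hW hT hH ha hb haA hbA (Nat.pos_of_mem_divisors hg.1)
      (Nat.pos_of_mem_divisors hg.2) (f := f) _ ?_
    intro x hx
    rw [Finset.mem_filter, Prod.mk.injEq] at hx
    obtain ⟨hx, e1, e2⟩ := hx
    obtain ⟨ea, eb, h, hgcd, hle, hr⟩ := hS x hx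
    refine ⟨ea, eb, e1, e2, ?_, hle, hr⟩
    rw [hr.gcd_eq, e1, e2] at hgcd
    exact_mod_cast hgcd

lemma card_small_free_part_le {A W T H : ℝ} (hA : 1 ≤ A) (hW : 1 ≤ W)
    (hT : 0 < T) (hH : DivBound (8 * A ^ 4 * W ^ 2) H)
    {f : Config → ℕ × ℕ × ℕ × Config} (S : Finset Config)
    (hS : ∀ x ∈ S, ((max x.a x.b : ℤ) : ℝ) ≤ A ∧ Adm W x ∧ T < (Int.gcd x.s x.t : ℝ) ∧
      ((f x).1 : ℝ) ≤ T ∧ IsReduction W x (f x).1 (f x).2.1 (f x).2.2.1 (f x).2.2.2) :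
    (S.card : ℝ) ≤ 128 * H ^ 7 * (W / T) + 16 * H ^ 5 * (A ^ 2 * ⌊T⌋₊) := by
  have hA4 := one_le_pow₀ hA (n := 4)
  have hAA : A ≤ A ^ 4 := le_self_pow₀ hA (by norm_num)
  have hW2 := one_le_pow₀ hW (n := 2)
  have hR1 : 1 ≤ 8 * A ^ 4 * W ^ 2 := by nlinarith
  have hAR : A ≤ 8 * A ^ 4 * W ^ 2 := by nlinarith
  have hH1 := hH.one_le hR1
  set n := ⌊A⌋₊ with hn
  have hnA : (n : ℝ) ≤ A := Nat.floor_le (by linarith)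
  have hsum := hH.sum_inv_le hR1 (hnA.trans hAR)
  have hle : ∀ x ∈ S, (x.a : ℝ) ≤ A ∧ (x.b : ℝ) ≤ A := by
    intro x hx
    exact ⟨le_trans (by exact_mod_cast le_max_left x.a x.b) (hS x hx).1,
      le_trans (by exact_mod_cast le_max_right x.a x.b) (hS x hx).1⟩
  have hmem : ∀ {c : ℤ}, 0 < c → (c : ℝ) ≤ A → c.natAbs ∈ Finset.Icc 1 n := by
    intro c hc h
    rw [Finset.mem_Icc]
    refine ⟨Int.natAbs_pos.2 hc.ne', Nat.le_floor ?_⟩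
    rwa [Nat.cast_natAbs, abs_of_pos hc]
  have key := card_le_sum_fiber S (fun x => (x.a.natAbs, x.b.natAbs))
    (Finset.Icc 1 n ×ˢ Finset.Icc 1 n)
    (fun n => 16 * H ^ 5 * (2 * W / T * (1 / (n.1 * n.2)) + ⌊T⌋₊)) ?_ ?_
  · refine key.trans ?_
    rw [Finset.sum_product]
    calc _ = 16 * H ^ 5 * (2 * W / T * ((∑ i ∈ Finset.Icc 1 n, (1 : ℝ) / i) *
          (∑ i ∈ Finset.Icc 1 n, (1 : ℝ) / i)) + (n : ℝ) ^ 2 * ⌊T⌋₊) := by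
          have e : ∀ i j : ℕ, 16 * H ^ 5 * (2 * W / T * (1 / ((i : ℝ) * j)) + ⌊T⌋₊) =
              16 * H ^ 5 * (2 * W / T * (1 / (i : ℝ) * (1 / (j : ℝ))) + ⌊T⌋₊) :=
            fun i j => by ring
          simp only [e, ← Finset.mul_sum, Finset.sum_add_distrib, Finset.sum_const, Nat.card_Icc,
            nsmul_eq_mul, Nat.add_sub_cancel, ← Finset.sum_mul]
          ring
      _ ≤ 16 * H ^ 5 * (2 * W / T * ((2 * H) * (2 * H)) + A ^ 2 * ⌊T⌋₊) := by
          have : 0 ≤ ∑ i ∈ Finset.Icc 1 n, (1 : ℝ) / i := by positivity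
          gcongr
      _ = _ := by ring
  · intro x hx
    obtain ⟨-, h, -⟩ := hS x hx
    rw [Finset.mem_product]
    exact ⟨hmem h.ha (hle x hx).1, hmem h.hb (hle x hx).2⟩
  · rintro ⟨m, k⟩ hmk
    simp only [Finset.mem_product, Finset.mem_Icc] at hmk
    obtain ⟨⟨m1, m2⟩, k1, k2⟩ := hmk
    have hmA : (m : ℝ) ≤ A := le_trans (by exact_mod_cast m2) hnA
    have hkA : (k : ℝ) ≤ A := le_trans (by exact_mod_cast k2) hnA
    have := card_fixed_ab_small_free_part_le (a := m) (b := k) hA hW hT hH (by exact_mod_cast m1)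
      (by exact_mod_cast k1) (by exact_mod_cast hmA) (by exact_mod_cast hkA) (f := f)
      (S.filter (fun x => (x.a.natAbs, x.b.natAbs) = (m, k))) (by
        intro x hx
        rw [Finset.mem_filter, Prod.mk.injEq] at hx
        obtain ⟨hx, e1, e2⟩ := hx
        obtain ⟨-, h, h1⟩ := hS x hx
        have := h.ha
        have := h.hb
        exact ⟨by omega, by omega, h, h1⟩)
    simpa only [Int.cast_natCast] using this

/-- The number of admissible points with `gcd(s, t) > T`. -/
lemma card_adm_le {A W T H : ℝ} (hA : 1 ≤ A) (hW : 1 ≤ W)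
    (hT : 0 < T) (hH : DivBound (8 * A ^ 4 * W ^ 2) H) (S : Finset Config)
    (hS : ∀ x ∈ S, ((max x.a x.b : ℤ) : ℝ) ≤ A ∧ Adm W x ∧ T < (Int.gcd x.s x.t : ℝ)) :
    (S.card : ℝ) ≤ 328448 * H ^ 11 * (A ^ 2 * ⌊T⌋₊ + W / T) := by
  have hA4 := one_le_pow₀ hA (n := 4)
  have hW2 := one_le_pow₀ hW (n := 2)
  have hR1 : 1 ≤ 8 * A ^ 4 * W ^ 2 := by nlinarith
  have hH1 := hH.one_le hR1
  have hex : ∀ x : Config, ∃ p : ℕ × ℕ × ℕ × Config, x ∈ S →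
      IsReduction W x p.1 p.2.1 p.2.2.1 p.2.2.2 := by
    intro x
    by_cases hx : x ∈ S
    · obtain ⟨p, hp⟩ := (hS x hx).2.1.exists_reduction
      exact ⟨p, fun _ => hp⟩
    · exact ⟨(0, 0, 0, x), fun h => absurd h hx⟩
  choose f hf using hex
  have h1 := card_small_free_part_le hA hW hT hH (f := f)
    (S.filter (fun x => ((f x).1 : ℝ) ≤ T)) (by
      intro x hx
      rw [Finset.mem_filter] at hx
      obtain ⟨p, q, r⟩ := hS x hx.1
      exact ⟨p, q, r, hx.2, hf x hx.1⟩)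
  have h2 := card_large_free_part_le hA hW hT hH (f := f)
    (S.filter (fun x => ¬ ((f x).1 : ℝ) ≤ T)) (by
      intro x hx
      rw [Finset.mem_filter] at hx
      obtain ⟨p, q, r⟩ := hS x hx.1
      exact ⟨p, not_le.1 hx.2, hf x hx.1⟩)
  rw [← Finset.card_filter_add_card_filter_not (s := S) (fun x => ((f x).1 : ℝ) ≤ T), Nat.cast_add]
  have e1 : H ^ 5 * (A ^ 2 * ⌊T⌋₊) ≤ H ^ 11 * (A ^ 2 * ⌊T⌋₊) := by
    have : H ^ 5 ≤ H ^ 11 := pow_le_pow_right₀ hH1 (by norm_num)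
    gcongr
  have e2 : H ^ 7 * (W / T) ≤ H ^ 11 * (W / T) := by
    have : H ^ 7 ≤ H ^ 11 := pow_le_pow_right₀ hH1 (by norm_num)
    gcongr
  have e3 : 0 ≤ H ^ 11 * (A ^ 2 * ⌊T⌋₊) := by positivity
  linarith

lemma card_divisors_le_rpow {n : ℕ} (hn : 0 < n) {δ E P : ℝ} (hE : 1 ≤ E) (hP : 0 ≤ P)
    (h₁ : ∀ p : ℕ, p.Prime → P ≤ p → 2 ≤ (p : ℝ) ^ δ)
    (h₂ : ∀ p e : ℕ, p.Prime → (e : ℝ) + 1 ≤ E * ((p : ℝ) ^ e) ^ δ) :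
    (n.divisors.card : ℝ) ≤ E ^ P * (n : ℝ) ^ δ := by
  have hE0 : 0 < E := by linarith
  have hpow : (n : ℝ) ^ δ = ∏ p ∈ n.primeFactors, ((p : ℝ) ^ n.factorization p) ^ δ := by
    rw [Real.finsetProd_rpow _ _ (fun i _ => by positivity)]
    conv_lhs => rw [← Nat.prod_factorization_pow_eq_self hn.ne']
    rw [Finsupp.prod, Nat.support_factorization]
    push_cast
    rfl
  have hcard : (((n.primeFactors.filter (fun p : ℕ => (p : ℝ) < P)).card : ℕ) : ℝ) ≤ P := by
    have : n.primeFactors.filter (fun p : ℕ => (p : ℝ) < P) ⊆ Finset.Icc 1 ⌊P⌋₊ := by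
      intro p hp
      rw [Finset.mem_filter] at hp
      rw [Finset.mem_Icc]
      exact ⟨(Nat.prime_of_mem_primeFactors hp.1).one_le, Nat.le_floor hp.2.le⟩
    have := Finset.card_le_card this
    rw [Nat.card_Icc, Nat.add_sub_cancel] at this
    exact le_trans (by exact_mod_cast this) (Nat.floor_le hP)
  rw [Nat.card_divisors hn.ne', Nat.cast_prod]
  calc ∏ p ∈ n.primeFactors, ((n.factorization p + 1 : ℕ) : ℝ)
      ≤ ∏ p ∈ n.primeFactors, ((if (p : ℝ) < P then E else 1) *
          ((p : ℝ) ^ n.factorization p) ^ δ) := by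
        refine Finset.prod_le_prod (fun _ _ => by positivity) fun p hp => ?_
        have hpp := Nat.prime_of_mem_primeFactors hp
        push_cast
        split_ifs with h
        · exact h₂ p _ hpp
        · rw [one_mul, ← Real.rpow_natCast, ← Real.rpow_mul (by positivity), mul_comm,
            Real.rpow_mul (by positivity), Real.rpow_natCast]
          calc (n.factorization p : ℝ) + 1 ≤ 2 ^ n.factorization p := by
                exact_mod_cast (Nat.lt_two_pow_self (n := n.factorization p))
            _ ≤ _ := by
                have := h₁ p hpp (not_lt.1 h)
                gcongr
    _ = E ^ (n.primeFactors.filter (fun p : ℕ => (p : ℝ) < P)).card * (n : ℝ) ^ δ := by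
        rw [Finset.prod_mul_distrib, ← hpow, Finset.prod_ite, Finset.prod_const,
          Finset.prod_const_one, mul_one]
    _ ≤ _ := by
        rw [← Real.rpow_natCast]
        gcongr

lemma one_lt_log_log {B : ℝ} (hB : 16 ≤ B) : 1 < Real.log (Real.log B) := by
  have h1 : 4 * Real.log 2 ≤ Real.log B := by
    have : Real.log (2 ^ 4) ≤ Real.log B := Real.log_le_log (by norm_num) (by norm_num; linarith)
    rwa [Real.log_pow] at this
  have h2 := Real.log_two_gt_d9
  have h3 := Real.exp_one_lt_d9
  rw [Real.lt_log_iff_exp_lt (by linarith)]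
  linarith

lemma exp_log_log {B : ℝ} (hB : 16 ≤ B) : Real.exp (Real.log (Real.log B)) = Real.log B :=
  Real.exp_log (Real.log_pos (by linarith))

/-- `B ^ (1 / log log B)` as an exponential. -/
lemma rpow_inv_log_log {B : ℝ} (hB : 16 ≤ B) : B ^ (1 / Real.log (Real.log B)) =
    Real.exp (Real.exp (Real.log (Real.log B)) / Real.log (Real.log B)) := by
  rw [exp_log_log hB, Real.rpow_def_of_pos (by linarith)]
  congr 1
  ring

lemma divBound_rpow {B : ℝ} (hB : 16 ≤ B) (k : ℝ) :
    DivBound (B ^ k) ((B ^ (1 / Real.log (Real.log B))) ^ (8 + 2 * k)) := by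
  intro n hn hnB
  have hy := one_lt_log_log hB
  set y := Real.log (Real.log B) with hy_def
  have hy0 : 0 < y := by linarith
  have hB0 : 0 < B := by linarith
  have hex := Real.exp_one_gt_d9
  have h := card_divisors_le_rpow hn (δ := 2 / y) (E := y) (P := Real.exp (y / 2)) hy.le
    (Real.exp_pos _).le ?_ ?_
  · refine h.trans ?_
    have h1 : (n : ℝ) ^ (2 / y) ≤ (B ^ (1 / y)) ^ (2 * k) := by
      calc (n : ℝ) ^ (2 / y) ≤ (B ^ k) ^ (2 / y) := by gcongr
        _ = (B ^ (1 / y)) ^ (2 * k) := by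
          rw [← Real.rpow_mul hB0.le, ← Real.rpow_mul hB0.le]
          congr 1; ring
    have h2 : y ^ Real.exp (y / 2) ≤ (B ^ (1 / y)) ^ (8 : ℝ) := by
      rw [hy_def, rpow_inv_log_log hB, ← hy_def, ← Real.exp_mul, Real.rpow_def_of_pos hy0,
        Real.exp_le_exp]
      have hl : Real.log y ≤ y := (Real.log_le_sub_one_of_pos hy0).trans (by linarith)
      have hq : (y / 2) ^ 2 / 2 ≤ Real.exp (y / 2) := by
        have := Real.quadratic_le_exp_of_nonneg (x := y / 2) (by positivity)
        linarith
      have he : Real.exp y = Real.exp (y / 2) * Real.exp (y / 2) := by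
        rw [← Real.exp_add]; congr 1; ring
      rw [he, div_mul_eq_mul_div, le_div_iff₀ hy0]
      have hp := Real.exp_pos (y / 2)
      calc Real.log y * Real.exp (y / 2) * y ≤ y * Real.exp (y / 2) * y := by gcongr
        _ = Real.exp (y / 2) * (y ^ 2) := by ring
        _ ≤ Real.exp (y / 2) * (8 * Real.exp (y / 2)) := by
          gcongr
          linarith
        _ = _ := by ring
    rw [Real.rpow_add (by positivity)]
    gcongr
  · intro p _ hpP
    calc (2 : ℝ) ≤ Real.exp (y / 2 * (2 / y)) := by
          rw [show y / 2 * (2 / y) = 1 by field_simp]; linarith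
      _ = Real.exp (y / 2) ^ (2 / y) := Real.exp_mul ..
      _ ≤ _ := by gcongr
  · intro p e hp
    have h2p : (2 : ℝ) ≤ p := by exact_mod_cast hp.two_le
    have hl2 := Real.log_two_gt_d9
    calc (e : ℝ) + 1 ≤ y * (1 + e / y) := by
          rw [mul_add, mul_div_cancel₀ _ hy0.ne']; linarith
      _ ≤ y * ((2 : ℝ) ^ e) ^ (2 / y) := by
          gcongr
          rw [← Real.rpow_natCast, ← Real.rpow_mul (by norm_num), Real.rpow_def_of_pos (by norm_num)]
          have := Real.add_one_le_exp (Real.log 2 * (e * (2 / y)))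
          refine le_trans ?_ this
          have : (e : ℝ) / y * 1 ≤ e / y * (2 * Real.log 2) := by gcongr; linarith
          have e3 : Real.log 2 * (e * (2 / y)) = e / y * (2 * Real.log 2) := by ring
          linarith
      _ ≤ _ := by gcongr

lemma finite_adm (A W : ℝ) : {x : Config | ((max x.a x.b : ℤ) : ℝ) ≤ A ∧ Adm W x}.Finite := by
  set R := 2 * A ^ 2 + 2 * A ^ 4 * |W| + |A| with hR
  let I := Finset.Icc (-⌊R⌋) ⌊R⌋
  refine (Finset.finite_toSet ((I ×ˢ I ×ˢ I ×ˢ I ×ˢ I ×ˢ I).image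
    (fun p : ℤ × ℤ × ℤ × ℤ × ℤ × ℤ => (⟨p.1, p.2.1, p.2.2.1, p.2.2.2.1, p.2.2.2.2.1,
      p.2.2.2.2.2⟩ : Config)))).subset ?_
  rintro x ⟨hm, h⟩
  have hmem : ∀ c : ℤ, |(c : ℝ)| ≤ R → c ∈ I := by
    intro c hc
    rw [Finset.mem_Icc, ← abs_le]
    exact Int.le_floor.2 (by exact_mod_cast hc)
  have ha : (0 : ℝ) < x.a := by exact_mod_cast h.ha
  have hb : (0 : ℝ) < x.b := by exact_mod_cast h.hb
  have hl₁ : (0 : ℝ) < x.l₁ := by exact_mod_cast h.hl₁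
  have hl₂ : (0 : ℝ) < x.l₂ := by exact_mod_cast h.hl₂
  have haA : (x.a : ℝ) ≤ A := le_trans (by exact_mod_cast le_max_left x.a x.b) hm
  have hbA : (x.b : ℝ) ≤ A := le_trans (by exact_mod_cast le_max_right x.a x.b) hm
  have ha2 : (x.a : ℝ) ^ 2 ≤ A ^ 2 := by gcongr
  have hb2 : (x.b : ℝ) ^ 2 ≤ A ^ 2 := by gcongr
  have hA2 : 0 ≤ A ^ 4 * |W| := by positivity
  have hA0 := le_abs_self A
  have hA1 := abs_nonneg A
  have hl₁A : (x.l₁ : ℝ) ≤ A ^ 2 := by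
    have h1 : x.l₁ ≤ |x.a ^ 2 - x.b ^ 2| :=
      Int.le_of_dvd (abs_pos.2 h.sub_ne_zero) ((dvd_abs _ _).2 h.dvd₁)
    have h2 : (x.l₁ : ℝ) ≤ |(x.a : ℝ) ^ 2 - x.b ^ 2| := by exact_mod_cast h1
    refine h2.trans (abs_le.2 ⟨?_, ?_⟩) <;> nlinarith
  have hl₂A : (x.l₂ : ℝ) ≤ 2 * A ^ 2 := by
    have h1 : x.l₂ ≤ x.a ^ 2 + x.b ^ 2 := Int.le_of_dvd h.add_pos h.dvd₂
    have h2 : (x.l₂ : ℝ) ≤ (x.a : ℝ) ^ 2 + x.b ^ 2 := by exact_mod_cast h1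
    linarith
  have hll : (x.l₁ : ℝ) * x.l₂ * W ≤ 2 * A ^ 4 * |W| := by
    calc (x.l₁ : ℝ) * x.l₂ * W ≤ x.l₁ * x.l₂ * |W| := by gcongr; exact le_abs_self W
      _ ≤ A ^ 2 * (2 * A ^ 2) * |W| := by gcongr
      _ = _ := by ring
  have hmax : (1 : ℝ) ≤ (max x.a x.b : ℤ) := by
    exact_mod_cast (lt_max_of_lt_left h.ha : 0 < max x.a x.b)
  have hprod : ∀ c e : ℤ, e ≠ 0 → |((c * e : ℤ) : ℝ)| * (max x.a x.b : ℤ) ≤ x.l₁ * x.l₂ * W →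
      |(c : ℝ)| ≤ R := by
    intro c e he hc
    have h1 := one_le_abs_cast he
    have h2 := abs_nonneg (c : ℝ)
    rw [Int.cast_mul, abs_mul] at hc
    have h3 : |(c : ℝ)| * 1 * 1 ≤ |(c : ℝ)| * |(e : ℝ)| * (max x.a x.b : ℤ) := by gcongr
    nlinarith [sq_nonneg A]
  rw [Finset.mem_coe, Finset.mem_image]
  refine ⟨(x.a, x.b, x.l₁, x.l₂, x.s, x.t), ?_, rfl⟩
  simp only [Finset.mem_product]
  refine ⟨hmem _ ?_, hmem _ ?_, hmem _ ?_, hmem _ ?_, hmem _ (hprod _ _ h.v0 h.bd₁),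
    hmem _ (hprod _ _ h.q0 h.bd₂)⟩
  · rw [abs_of_pos ha]; nlinarith [sq_nonneg A]
  · rw [abs_of_pos hb]; nlinarith [sq_nonneg A]
  · rw [abs_of_pos hl₁]; nlinarith [sq_nonneg A]
  · rw [abs_of_pos hl₂]; nlinarith [sq_nonneg A]

lemma adm_of_mem_Rdag {a b s t : ℤ} {l₁ l₂ : ℕ} {X W : ℝ} (ha : 0 < a) (hb : 0 < b)
    (hab : Int.gcd a b = 1) (hne : a * b ≠ 1) (hl₁ : Odd l₁) (hl₂ : Odd l₂)
    (hd₁ : (l₁ : ℤ) ∣ a ^ 2 - b ^ 2) (hd₂ : (l₂ : ℤ) ∣ a ^ 2 + b ^ 2) (hs : (l₁ : ℤ) ∣ s)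
    (hv : (l₂ : ℤ) ∣ s - a * t) (hX : X * (max a b : ℤ) ≤ l₁ * l₂ * W)
    (h : (s, t) ∈ Rdag a b X) : Adm W ⟨a, b, l₁, l₂, s, t⟩ := by
  obtain ⟨-, -, -, h1, h2, h3, h4⟩ := h
  simp only [Q1, Q2] at h1 h2 h3 h4
  have hmax : (0 : ℝ) < (max a b : ℤ) := by exact_mod_cast lt_max_of_lt_left ha
  have hX0 : 0 ≤ X := le_trans (by positivity) h1
  push_cast at h1 h2
  rw [abs_le] at h1 h2
  have hv0 : s - a * t ≠ 0 := fun h => h3 (by rw [h, mul_zero])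
  have ht0 : t ≠ 0 := fun h => h3 (by rw [h, mul_zero, zero_mul])
  have hs0 : s ≠ 0 := fun h => h3 (by rw [h, zero_mul, zero_mul])
  refine ⟨ha, hb, hab, ?_, ?_, ?_, ?_, ?_, hd₁, hd₂, hs, hv, hs0, ht0, hv0, ?_, ?_, ?_⟩
  · rintro h0
    simp only [] at h0
    rw [← h0, Int.gcd_self] at hab
    have : a = 1 := by omega
    exact hne (by rw [← h0, this, one_mul])
  · show (0 : ℤ) < (l₁ : ℤ)
    exact_mod_cast hl₁.pos
  · show (0 : ℤ) < (l₂ : ℤ)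
    exact_mod_cast hl₂.pos
  · show Odd (l₁ : ℤ)
    exact_mod_cast hl₁
  · show Odd (l₂ : ℤ)
    exact_mod_cast hl₂
  · simp only [Config.q]
    intro h0
    exact h4 (by linarith)
  · simp only [Int.cast_natCast]
    refine le_trans (mul_le_mul_of_nonneg_right ?_ hmax.le) hX
    push_cast
    rw [abs_le]
    constructor <;> nlinarith
  · simp only [Int.cast_natCast, Config.q]
    refine le_trans (mul_le_mul_of_nonneg_right ?_ hmax.le) hX
    push_cast
    rw [abs_le]
    constructor <;> nlinarith

lemma Adm.gcd_le {W : ℝ} {x : Config} (h : Adm W x) : Int.gcd x.s x.t ≤ ⌊W⌋₊ := by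
  obtain ⟨p, hp⟩ := h.exists_reduction
  rw [hp.gcd_eq]
  exact (le_floor_of_pow_mul_le hp.hm hp.hg₁ hp.hg₂ hp.le).2.2.2

/-- Summing over `ℓ` costs a divisor function. -/
lemma tsum_Ldag_le {a b : ℤ} {k₁ k₂ l₁ l₂ : ℕ} {X W T R H : ℝ} (hR : W ≤ R)
    (hW : 1 ≤ W) (hH : DivBound R H)
    (G : Finset Config) (hG : ∀ x ∈ G, Adm W x)
    (hmem : ∀ s t : ℤ, (l₁ : ℤ) ∣ s → (l₂ : ℤ) ∣ s - a * t → (s, t) ∈ Rdag a b X →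
      T < (Int.gcd s t : ℝ) → (⟨a, b, l₁, l₂, s, t⟩ : Config) ∈ G) :
    (∑' ℓ : ℕ, if Odd ℓ ∧ 0 < ℓ then (Ldag a b k₁ k₂ l₁ l₂ ℓ X T : ℝ) else 0) ≤ H * G.card := by
  have hL : ∀ ℓ : ℕ, Ldag a b k₁ k₂ l₁ l₂ ℓ X T ≤
      (G.filter (fun x => ℓ ∣ Int.gcd x.s x.t)).card := by
    intro ℓ
    refine le_trans ?_ (Finset.card_image_le (f := fun x : Config => (x.s, x.t)))
    rw [← Set.ncard_coe_finset]
    refine Set.ncard_le_ncard ?_ (Finset.finite_toSet _)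
    rintro ⟨s, t⟩ ⟨h1, h2, h3, h4, h5⟩
    have d1 : (l₁ : ℤ) ∣ s := dvd_trans (Int.natCast_dvd_natCast.2
      ((Nat.dvd_mul_left l₁ k₁).trans (Nat.dvd_lcm_left _ _))) h1
    have d2 : (ℓ : ℤ) ∣ s := dvd_trans (Int.natCast_dvd_natCast.2 (Nat.dvd_lcm_right _ _)) h1
    have d3 : (l₂ : ℤ) ∣ s - a * t :=
      dvd_trans (Int.natCast_dvd_natCast.2 (Nat.dvd_mul_left l₂ k₂)) h2
    rw [Finset.mem_coe, Finset.mem_image]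
    refine ⟨_, Finset.mem_filter.2 ⟨hmem s t d1 d3 h4 h5, ?_⟩, rfl⟩
    exact Int.natCast_dvd_natCast.1 (Int.dvd_coe_gcd d2 h3)
  have hgcd0 : ∀ x ∈ G, 0 < Int.gcd x.s x.t := fun x hx =>
    Int.gcd_pos_of_ne_zero_left _ (hG x hx).s0
  rw [tsum_eq_sum (s := Finset.Icc 1 ⌊W⌋₊)]
  · calc _ ≤ ∑ ℓ ∈ Finset.Icc 1 ⌊W⌋₊, ((G.filter (fun x => ℓ ∣ Int.gcd x.s x.t)).card : ℝ) := by
          refine Finset.sum_le_sum fun ℓ _ => ?_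
          split_ifs
          · exact_mod_cast hL ℓ
          · positivity
      _ = ∑ x ∈ G, (((Finset.Icc 1 ⌊W⌋₊).filter (fun ℓ => ℓ ∣ Int.gcd x.s x.t)).card : ℝ) := by
          simp only [Finset.card_filter, Nat.cast_sum]
          exact Finset.sum_comm
      _ ≤ ∑ x ∈ G, H := by
          refine Finset.sum_le_sum fun x hx => ?_
          have h0 := hgcd0 x hx
          refine le_trans ?_ (hH _ h0 ?_)
          · have : (Finset.Icc 1 ⌊W⌋₊).filter (fun ℓ => ℓ ∣ Int.gcd x.s x.t) ⊆
                (Int.gcd x.s x.t).divisors := by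
              intro ℓ hℓ
              rw [Finset.mem_filter] at hℓ
              exact Nat.mem_divisors.2 ⟨hℓ.2, h0.ne'⟩
            exact_mod_cast Finset.card_le_card this
          · refine le_trans ?_ ((Nat.floor_le (by linarith : 0 ≤ W)).trans hR)
            exact_mod_cast (hG x hx).gcd_le
      _ = H * G.card := by rw [Finset.sum_const, nsmul_eq_mul, mul_comm]
  · intro ℓ hℓ
    split_ifs with h
    · have : (G.filter (fun x => ℓ ∣ Int.gcd x.s x.t)) = ∅ := by
        rw [Finset.filter_eq_empty_iff]
        intro x hx hdvd
        apply hℓ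
        rw [Finset.mem_Icc]
        exact ⟨h.2, (Nat.le_of_dvd (hgcd0 x hx) hdvd).trans (hG x hx).gcd_le⟩
      have h1 := hL ℓ
      rw [this, Finset.card_empty] at h1
      exact_mod_cast Nat.le_zero.1 h1
    · rfl

lemma sum_card_filter_le (Ω : Finset Config) (I : Finset ℤ) (D₁ D₂ : ℤ → ℤ → Finset ℕ) :
    ∑ a ∈ I, ∑ b ∈ I, ∑ l₁ ∈ D₁ a b, ∑ l₂ ∈ D₂ a b,
      ((Ω.filter (fun x : Config => x.a = a ∧ x.b = b ∧ x.l₁ = (l₁ : ℤ) ∧ x.l₂ = (l₂ : ℤ))).card : ℝ) ≤ Ω.card := by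
  have hin : ∀ a b : ℤ, ∑ l₁ ∈ D₁ a b, ∑ l₂ ∈ D₂ a b,
      (Ω.filter (fun x : Config => x.a = a ∧ x.b = b ∧ x.l₁ = (l₁ : ℤ) ∧ x.l₂ = (l₂ : ℤ))).card ≤
      (Ω.filter (fun x : Config => x.a = a ∧ x.b = b)).card := by
    intro a b
    rw [← Finset.sum_product']
    rw [← Finset.card_biUnion]
    · refine Finset.card_le_card ?_
      intro x hx
      simp only [Finset.mem_biUnion, Finset.mem_filter] at hx ⊢
      obtain ⟨_, _, h⟩ := hx
      exact ⟨h.1, h.2.1, h.2.2.1⟩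
    · rintro ⟨p, q⟩ - ⟨p', q'⟩ - hne
      rw [Function.onFun, Finset.disjoint_left]
      intro x hx hx'
      simp only [Finset.mem_filter] at hx hx'
      apply hne
      rw [Prod.mk.injEq]
      omega
  have hout : ∑ a ∈ I, ∑ b ∈ I, (Ω.filter (fun x : Config => x.a = a ∧ x.b = b)).card ≤ Ω.card := by
    rw [← Finset.sum_product']
    rw [← Finset.card_biUnion]
    · refine Finset.card_le_card ?_
      intro x hx
      simp only [Finset.mem_biUnion, Finset.mem_filter] at hx
      obtain ⟨_, _, h⟩ := hx
      exact h.1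
    · rintro ⟨p, q⟩ - ⟨p', q'⟩ - hne
      rw [Function.onFun, Finset.disjoint_left]
      intro x hx hx'
      simp only [Finset.mem_filter] at hx hx'
      apply hne
      rw [Prod.mk.injEq]
      omega
  have : ∑ a ∈ I, ∑ b ∈ I, ∑ l₁ ∈ D₁ a b, ∑ l₂ ∈ D₂ a b,
      (Ω.filter (fun x : Config => x.a = a ∧ x.b = b ∧ x.l₁ = (l₁ : ℤ) ∧ x.l₂ = (l₂ : ℤ))).card ≤ Ω.card :=
    le_trans (Finset.sum_le_sum fun a _ => Finset.sum_le_sum fun b _ => hin a b) hout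
  exact_mod_cast this

lemma log_le_rpow {B : ℝ} (hB : 16 ≤ B) :
    Real.log B ≤ (B ^ (1 / Real.log (Real.log B))) ^ (2 : ℝ) := by
  have hy := one_lt_log_log hB
  rw [rpow_inv_log_log hB, ← exp_log_log hB]
  simp only [Real.log_exp]
  set y := Real.log (Real.log B)
  have hy0 : 0 < y := by linarith
  rw [← Real.exp_mul, Real.exp_le_exp, div_mul_eq_mul_div, le_div_iff₀ hy0]
  have := Real.quadratic_le_exp_of_nonneg hy0.le
  nlinarith

lemma ite_le_of_imp {P : Prop} [Decidable P] {x y : ℝ} (hy : 0 ≤ y) (h : P → x ≤ y) :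
    (if P then x else 0) ≤ y := by
  split_ifs with hP
  · exact h hP
  · exact hy

/-- The power-of-`Z` bookkeeping. -/
lemma final_numeric {B T A Y N c : ℝ} (hB : 16 ≤ B) (hT : 0 < T) (hA : 1 ≤ A) (hY : 1 ≤ Y)
    (hN : N ≤ c * ((B ^ (1 / Real.log (Real.log B))) ^ (38 : ℝ)) ^ 11 *
      (A ^ 2 * ⌊T⌋₊ + (Y * Real.log B) / T)) (hc : 0 < c) :
    Real.log B * (Real.log B ^ 50 * (Real.log B ^ 50 *
      ((B ^ (1 / Real.log (Real.log B))) ^ (38 : ℝ) * N))) ≤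
    c * (A ^ 2 * (B ^ (1 / Real.log (Real.log B))) ^ (660 : ℝ) * (⌊T⌋₊ : ℝ) +
          Y * (B ^ (1 / Real.log (Real.log B))) ^ (660 : ℝ) / T) := by
  have hL := log_le_rpow hB
  have hy := one_lt_log_log hB
  have hL0 : 0 ≤ Real.log B := Real.log_nonneg (by linarith)
  have hZ : 1 ≤ B ^ (1 / Real.log (Real.log B)) :=
    Real.one_le_rpow (by linarith) (by positivity)
  set Z := B ^ (1 / Real.log (Real.log B))
  set L := Real.log B
  have e2 : Z ^ (2 : ℝ) = Z ^ 2 := by exact_mod_cast Real.rpow_natCast Z 2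
  have e38 : Z ^ (38 : ℝ) = Z ^ 38 := by exact_mod_cast Real.rpow_natCast Z 38
  have e660 : Z ^ (660 : ℝ) = Z ^ 660 := by exact_mod_cast Real.rpow_natCast Z 660
  rw [e2] at hL
  rw [e38] at hN ⊢
  rw [e660]
  have hZ0 : 0 ≤ Z := by linarith
  have hF : (0 : ℝ) ≤ (⌊T⌋₊ : ℝ) := Nat.cast_nonneg _
  have hL50 : L ^ 50 ≤ (Z ^ 2) ^ 50 := pow_le_pow_left₀ hL0 hL 50
  have hL50' : 0 ≤ L ^ 50 := pow_nonneg hL0 50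
  have hZ38 : 0 ≤ Z ^ 38 := pow_nonneg hZ0 38
  have h658 : Z ^ 658 ≤ Z ^ 660 := pow_le_pow_right₀ hZ (by norm_num)
  have hM : L ^ 50 * L ^ 50 ≤ (Z ^ 2) ^ 50 * (Z ^ 2) ^ 50 :=
    mul_le_mul hL50 hL50 hL50' (hL50'.trans hL50)
  have hLM : L * (L ^ 50 * L ^ 50) ≤ Z ^ 2 * ((Z ^ 2) ^ 50 * (Z ^ 2) ^ 50) :=
    mul_le_mul hL hM (mul_nonneg hL50' hL50') (hL0.trans hL)
  have hYL : A ^ 2 * ⌊T⌋₊ + Y * L / T ≤ A ^ 2 * ⌊T⌋₊ + Y * Z ^ 2 / T := by gcongr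
  have hN' : Z ^ 38 * N ≤ Z ^ 38 * (c * (Z ^ 38) ^ 11 * (A ^ 2 * ⌊T⌋₊ + Y * Z ^ 2 / T)) :=
    mul_le_mul_of_nonneg_left (hN.trans (mul_le_mul_of_nonneg_left hYL
      (mul_nonneg hc.le (pow_nonneg hZ38 11)))) hZ38
  have hrhs : 0 ≤ Z ^ 38 * (c * (Z ^ 38) ^ 11 * (A ^ 2 * ⌊T⌋₊ + Y * Z ^ 2 / T)) :=
    mul_nonneg hZ38 (mul_nonneg (mul_nonneg hc.le (pow_nonneg hZ38 11)) (by positivity))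
  calc L * (L ^ 50 * (L ^ 50 * (Z ^ 38 * N))) = L * (L ^ 50 * L ^ 50) * (Z ^ 38 * N) := by ring
    _ ≤ L * (L ^ 50 * L ^ 50) *
        (Z ^ 38 * (c * (Z ^ 38) ^ 11 * (A ^ 2 * ⌊T⌋₊ + Y * Z ^ 2 / T))) :=
      mul_le_mul_of_nonneg_left hN' (mul_nonneg hL0 (mul_nonneg hL50' hL50'))
    _ ≤ Z ^ 2 * ((Z ^ 2) ^ 50 * (Z ^ 2) ^ 50) *
        (Z ^ 38 * (c * (Z ^ 38) ^ 11 * (A ^ 2 * ⌊T⌋₊ + Y * Z ^ 2 / T))) :=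
      mul_le_mul_of_nonneg_right hLM hrhs
    _ = c * (A ^ 2 * Z ^ 658 * ⌊T⌋₊ + Y * Z ^ 660 / T) := by ring
    _ ≤ _ := by gcongr

/-- Discarding the conditions and the outer auxiliary variables. -/
lemma sum_drop_le {y L K H : ℝ} (hy : 0 ≤ y) (hK0 : 0 ≤ K) (hyL : Real.exp y = L) (hH : 0 ≤ H)
    (D₁ D₂ : Finset ℕ) (N : ℕ → ℕ → ℝ) (hN : ∀ i j, 0 ≤ N i j)
    (P : ℕ → Prop) (P₁ P₂ : ℕ → ℕ → Prop) [∀ i, Decidable (P i)]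
    [∀ i j, Decidable (P₁ i j)] [∀ i j, Decidable (P₂ i j)] (F : ℕ → ℕ → ℕ → ℕ → ℕ → ℝ)
    (hF : ∀ ν k₁ l₁ k₂ l₂, P ν → P₁ k₁ l₁ → P₂ k₂ l₂ → F ν k₁ l₁ k₂ l₂ ≤ H * N l₁ l₂) :
    (∑ ν ∈ Finset.range (⌊y⌋₊ + 1), if P ν then
      ∑ k₁ ∈ Finset.Icc 1 ⌊K⌋₊, ∑ l₁ ∈ D₁, if P₁ k₁ l₁ then
        ∑ k₂ ∈ Finset.Icc 1 ⌊K⌋₊, ∑ l₂ ∈ D₂, if P₂ k₂ l₂ then F ν k₁ l₁ k₂ l₂ else 0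
        else 0
      else 0) ≤ L * (K * (K * (H * ∑ l₁ ∈ D₁, ∑ l₂ ∈ D₂, N l₁ l₂))) := by
  have hK : ∀ x : ℝ, 0 ≤ x → ((Finset.Icc 1 ⌊K⌋₊).card : ℝ) * x ≤ K * x := by
    intro x hx
    gcongr
    rw [Nat.card_Icc, Nat.add_sub_cancel]
    exact Nat.floor_le (by positivity)
  have hS : ∀ l₁, 0 ≤ H * ∑ l₂ ∈ D₂, N l₁ l₂ := fun l₁ =>
    mul_nonneg hH (Finset.sum_nonneg fun j _ => hN l₁ j)
  have h2 : ∀ ν k₁ l₁, P ν → P₁ k₁ l₁ →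
      (∑ k₂ ∈ Finset.Icc 1 ⌊K⌋₊, ∑ l₂ ∈ D₂, if P₂ k₂ l₂ then F ν k₁ l₁ k₂ l₂ else 0) ≤
      K * (H * ∑ l₂ ∈ D₂, N l₁ l₂) := by
    intro ν k₁ l₁ h h'
    refine le_trans (Finset.sum_le_card_nsmul _ _ (H * ∑ l₂ ∈ D₂, N l₁ l₂) fun k₂ _ => ?_) ?_
    · rw [Finset.mul_sum]
      exact Finset.sum_le_sum fun l₂ _ =>
        ite_le_of_imp (mul_nonneg hH (hN _ _)) (hF ν k₁ l₁ k₂ l₂ h h')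
    · rw [nsmul_eq_mul]
      exact hK _ (hS l₁)
  have hS' : 0 ≤ K * (H * ∑ l₁ ∈ D₁, ∑ l₂ ∈ D₂, N l₁ l₂) := by
    have := Finset.sum_nonneg fun i (_ : i ∈ D₁) => Finset.sum_nonneg fun j (_ : j ∈ D₂) => hN i j
    positivity
  have h1 : ∀ ν, P ν → (∑ k₁ ∈ Finset.Icc 1 ⌊K⌋₊, ∑ l₁ ∈ D₁, if P₁ k₁ l₁ then
        ∑ k₂ ∈ Finset.Icc 1 ⌊K⌋₊, ∑ l₂ ∈ D₂, if P₂ k₂ l₂ then F ν k₁ l₁ k₂ l₂ else 0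
        else 0) ≤ K * (K * (H * ∑ l₁ ∈ D₁, ∑ l₂ ∈ D₂, N l₁ l₂)) := by
    intro ν h
    refine le_trans (Finset.sum_le_card_nsmul _ _
      (K * (H * ∑ l₁ ∈ D₁, ∑ l₂ ∈ D₂, N l₁ l₂)) fun k₁ _ => ?_) ?_
    · rw [Finset.mul_sum, Finset.mul_sum]
      exact Finset.sum_le_sum fun l₁ _ =>
        ite_le_of_imp (mul_nonneg (by positivity) (hS l₁)) (h2 ν k₁ l₁ h)
    · rw [nsmul_eq_mul]
      exact hK _ hS'
  refine le_trans (Finset.sum_le_card_nsmul _ _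
    (K * (K * (H * ∑ l₁ ∈ D₁, ∑ l₂ ∈ D₂, N l₁ l₂))) fun ν _ =>
      ite_le_of_imp (mul_nonneg (by positivity) hS') (h1 ν)) ?_
  rw [nsmul_eq_mul, Finset.card_range]
  refine mul_le_mul_of_nonneg_right ?_ (mul_nonneg (by positivity) hS')
  have h3 := Nat.floor_le hy
  have h4 := Real.add_one_le_exp y
  push_cast
  linarith

lemma sum_sum_le_mul {F G : ℤ → ℤ → ℝ} (I : Finset ℤ) (L K H : ℝ)
    (h : ∀ a ∈ I, ∀ b ∈ I, F a b ≤ L * (K * (K * (H * G a b)))) :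
    ∑ a ∈ I, ∑ b ∈ I, F a b ≤ L * (K * (K * (H * ∑ a ∈ I, ∑ b ∈ I, G a b))) := by
  simp only [Finset.mul_sum]
  exact Finset.sum_le_sum fun a ha => Finset.sum_le_sum fun b hb => h a ha b hb

theorem sum_Ldag_bound (c₀ : ℝ) (hc₀ : 0 < c₀) :
    ∃ C₁ C₂ : ℝ, 0 < C₁ ∧ 0 < C₂ ∧
      ∀ B T A Y : ℝ, 16 ≤ B → 0 < T → 1 ≤ A →
        A ≤ Real.sqrt B / (B ^ (1 / Real.log (Real.log B))) ^ c₀ →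
        1 ≤ Y → Y ≤ B ^ 5 →
        (∑ a ∈ Finset.Icc (1 : ℤ) ⌊A⌋, ∑ b ∈ Finset.Icc (1 : ℤ) ⌊A⌋,
          if Int.gcd a b = 1 ∧ a * b ≠ 1 ∧
              (padicValInt 2 (a ^ 2 - b ^ 2) : ℝ) ≤ Real.log (Real.log B) ∧
              ((max a b : ℤ) : ℝ) ≤ A then
            ∑ ν ∈ Finset.range (⌊Real.log (Real.log B)⌋₊ + 1),
              if (ν : ℝ) ≤ Real.log (Real.log B) then
                ∑ k₁ ∈ Finset.Icc 1 ⌊(Real.log B) ^ (50 : ℕ)⌋₊,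
                  ∑ l₁ ∈ (a ^ 2 - b ^ 2).natAbs.divisors,
                    if Odd k₁ ∧ Odd l₁ ∧ ((k₁ * l₁ : ℕ) : ℤ) ∣ (a ^ 2 - b ^ 2) ∧
                        (k₁ : ℝ) ≤ (Real.log B) ^ (50 : ℕ) then
                      ∑ k₂ ∈ Finset.Icc 1 ⌊(Real.log B) ^ (50 : ℕ)⌋₊,
                        ∑ l₂ ∈ (a ^ 2 + b ^ 2).natAbs.divisors,
                          if Odd k₂ ∧ Odd l₂ ∧
                              ((k₂ * l₂ : ℕ) : ℤ) ∣ (a ^ 2 + b ^ 2) ∧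
                              (k₂ : ℝ) ≤ (Real.log B) ^ (50 : ℕ) then
                            ∑' ℓ : ℕ, if Odd ℓ ∧ 0 < ℓ then
                              (Ldag a b k₁ k₂ l₁ l₂ ℓ
                                ((2 : ℝ) ^ ν * (l₁ : ℝ) * (l₂ : ℝ) * Y /
                                  ((max a b : ℤ) : ℝ)) T : ℝ)
                            else 0
                          else 0
                    else 0
              else 0
          else 0) ≤
        C₁ * (A ^ 2 * (B ^ (1 / Real.log (Real.log B))) ^ C₂ * (⌊T⌋₊ : ℝ) +
          Y * (B ^ (1 / Real.log (Real.log B))) ^ C₂ / T) := by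
  refine ⟨328448, 660, by norm_num, by norm_num, ?_⟩
  intro B T A Y hB hT hA hAB hY hYB
  have hy := one_lt_log_log hB
  have hexp := exp_log_log hB
  have hL1 : 1 ≤ Real.log B := by
    rw [← hexp]
    exact Real.one_le_exp (by linarith)
  have hLB : Real.log B ≤ B := (Real.log_le_sub_one_of_pos (by linarith)).trans (by linarith)
  have hZ : 1 ≤ B ^ (1 / Real.log (Real.log B)) :=
    Real.one_le_rpow (by linarith) (by positivity)
  have hA2 : A ^ 2 ≤ B := by
    have h1 : A ≤ Real.sqrt B :=
      hAB.trans (div_le_self (Real.sqrt_nonneg _) (Real.one_le_rpow hZ hc₀.le))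
    calc A ^ 2 ≤ Real.sqrt B ^ 2 := by gcongr
      _ = B := Real.sq_sqrt (by linarith)
  have hW : 1 ≤ Y * Real.log B := one_le_mul_of_one_le_of_one_le hY hL1
  have hR : 8 * A ^ 4 * (Y * Real.log B) ^ 2 ≤ B ^ (15 : ℝ) := by
    have e15 : B ^ (15 : ℝ) = B ^ 15 := by exact_mod_cast Real.rpow_natCast B 15
    rw [e15]
    calc 8 * A ^ 4 * (Y * Real.log B) ^ 2 = 8 * (A ^ 2) ^ 2 * (Y * Real.log B) ^ 2 := by ring
      _ ≤ B * B ^ 2 * (B ^ 5 * B) ^ 2 := by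
        gcongr
        linarith
      _ = B ^ 15 := by ring
  have hH : DivBound (8 * A ^ 4 * (Y * Real.log B) ^ 2)
      ((B ^ (1 / Real.log (Real.log B))) ^ (38 : ℝ)) := by
    have := (divBound_rpow hB 15).mono hR
    norm_num at this ⊢
    exact this
  have hWR : Y * Real.log B ≤ 8 * A ^ 4 * (Y * Real.log B) ^ 2 := by
    have : (1 : ℝ) ≤ A ^ 4 := one_le_pow₀ hA
    nlinarith
  set H := (B ^ (1 / Real.log (Real.log B))) ^ (38 : ℝ) with hHdef
  have hH0 : 0 ≤ H := by positivity
  set W := Y * Real.log B with hWdef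
  set Ω : Finset Config :=
    (finite_adm A W).toFinset.filter (fun x => T < (Int.gcd x.s x.t : ℝ)) with hΩ
  have hΩmem : ∀ x ∈ Ω, ((max x.a x.b : ℤ) : ℝ) ≤ A ∧ Adm W x ∧ T < (Int.gcd x.s x.t : ℝ) := by
    intro x hx
    rw [hΩ, Finset.mem_filter, Set.Finite.mem_toFinset] at hx
    exact ⟨hx.1.1, hx.1.2, hx.2⟩
  have hcard := card_adm_le hA hW hT hH Ω hΩmem
  refine le_trans ?_ (final_numeric hB hT hA hY hcard (by norm_num))
  have hpart := sum_card_filter_le Ω (Finset.Icc (1 : ℤ) ⌊A⌋)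
    (fun a b => (a ^ 2 - b ^ 2).natAbs.divisors) (fun a b => (a ^ 2 + b ^ 2).natAbs.divisors)
  have hK0 : 0 ≤ Real.log B ^ 50 := pow_nonneg (by linarith) 50
  refine le_trans ?_ (mul_le_mul_of_nonneg_left (mul_le_mul_of_nonneg_left
    (mul_le_mul_of_nonneg_left (mul_le_mul_of_nonneg_left hpart hH0) hK0) hK0)
    (by linarith : 0 ≤ Real.log B))
  refine sum_sum_le_mul _ _ _ _ fun a ha b hb => ?_
  rw [Finset.mem_Icc] at ha hb
  have ha0 : 0 < a := by linarith [ha.1]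
  have hb0 : 0 < b := by linarith [hb.1]
  have hmax : (0 : ℝ) < (max a b : ℤ) := by exact_mod_cast lt_max_of_lt_left ha0
  refine ite_le_of_imp (mul_nonneg (by linarith) (mul_nonneg hK0 (mul_nonneg hK0
    (mul_nonneg hH0 (Finset.sum_nonneg fun _ _ => Finset.sum_nonneg fun _ _ =>
      Nat.cast_nonneg _))))) ?_
  rintro ⟨hab, hne, -, hmaxA⟩
  refine sum_drop_le (by linarith) hK0 hexp hH0 _ _ _ (fun _ _ => Nat.cast_nonneg _)
    _ _ _ _ ?_
  rintro ν k₁ l₁ k₂ l₂ hν ⟨-, ho₁, hd₁, -⟩ ⟨-, ho₂, hd₂, -⟩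
  refine tsum_Ldag_le hWR hW hH _ ?_ ?_
  · intro x hx
    exact (hΩmem x (Finset.mem_filter.1 hx).1).2.1
  · intro s t hs hv hst hTg
    have hadm : Adm W ⟨a, b, l₁, l₂, s, t⟩ := by
      refine adm_of_mem_Rdag ha0 hb0 hab hne ho₁ ho₂
        (dvd_trans (Int.natCast_dvd_natCast.2 (Nat.dvd_mul_left _ _)) hd₁)
        (dvd_trans (Int.natCast_dvd_natCast.2 (Nat.dvd_mul_left _ _)) hd₂) hs hv ?_ hst
      rw [div_mul_cancel₀ _ hmax.ne', hWdef]
      have h2 : (2 : ℝ) ^ ν ≤ Real.log B := by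
        calc (2 : ℝ) ^ ν ≤ Real.exp 1 ^ ν := by
              gcongr
              linarith [Real.add_one_le_exp (1 : ℝ)]
          _ = Real.exp ν := by rw [← Real.exp_nat_mul, mul_one]
          _ ≤ Real.log B := by
              rw [← hexp]
              exact Real.exp_le_exp.2 hν
      calc (2 : ℝ) ^ ν * l₁ * l₂ * Y ≤ Real.log B * l₁ * l₂ * Y := by gcongr
        _ = l₁ * l₂ * (Y * Real.log B) := by ring
    rw [Finset.mem_filter, hΩ, Finset.mem_filter, Set.Finite.mem_toFinset]
    exact ⟨⟨⟨hmaxA, hadm⟩, hTg⟩, rfl, rfl, rfl, rfl⟩
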